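/- arXiv:1002.1472 — 3 statements merged into one kernel-verified Lean document; each statement's English description precedes it below -/
import Mathlib

section
/- Let q ∈ (1/2,1), let α(x) = x₁/r, set σ_ij(x) = (α(x)/r)(x_i x_j/r² − δ_ij/2), and suppose a C² Riemannian metric ḡ on an exterior region {|x| ≥ ρ₀} satisfies ḡ_ij = (1 + A/r)δ_ij + σ_ij + O₂(r^{−1−q}) for a constant A ≠ 0 and R_ḡ = 0 on {|x| ≥ ρ₀}. Then the surface integrals defining the first component of the center of mass diverge: with I₁(ρ) = ∫_{|x|=ρ} [ x₁ Σ_{i,j}(∂_i ḡ_ij − ∂_j ḡ_ii)(x_j/ρ) − Σ_i( ḡ_i1 (x_i/ρ) − ḡ_ii (x₁/ρ) ) ] dS, one has |I₁(ρ)| → ∞ as ρ → ∞. -/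
open MeasureTheory Filter

noncomputable section

/-- Points of `ℝ³`. -/
abbrev E3 := EuclideanSpace ℝ (Fin 3)

/-- Partial derivative of `f` in the `i`-th coordinate direction. -/
def pd (f : E3 → ℝ) (i : Fin 3) (x : E3) : ℝ :=
  fderiv ℝ f x (EuclideanSpace.single i 1)

/-- Christoffel symbols `Γ^k_{ij} = (1/2) Σ_l g^{kl} (∂_j g_{il} + ∂_i g_{jl} − ∂_l g_{ij})`. -/
def Gamma (g : E3 → Matrix (Fin 3) (Fin 3) ℝ) (k i j : Fin 3) (x : E3) : ℝ :=
  (1 / 2) * ∑ l, (g x)⁻¹ k l *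
    (pd (fun y => g y i l) j x + pd (fun y => g y j l) i x - pd (fun y => g y i j) l x)

/-- Scalar curvature
`R_g = Σ_{i,k} g^{ik} (Σ_j (∂_j Γ^j_{ik} − ∂_i Γ^j_{jk}) + Σ_{j,m} (Γ^m_{ik}Γ^j_{jm} − Γ^m_{jk}Γ^j_{im}))`. -/
def scalarCurvature (g : E3 → Matrix (Fin 3) (Fin 3) ℝ) (x : E3) : ℝ :=
  ∑ i, ∑ k, (g x)⁻¹ i k *
    ((∑ j, (pd (fun y => Gamma g j i k y) j x - pd (fun y => Gamma g j j k y) i x))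
      + ∑ j, ∑ m, (Gamma g m i k x * Gamma g j j m x - Gamma g m j k x * Gamma g j i m x))

/-- The Kronecker delta. -/
def kron (i j : Fin 3) : ℝ := if i = j then 1 else 0

/-- `f = O₂(r^{−s})` on the region `{‖x‖ ≥ ρ₀}`. -/
def IsO2 (f : E3 → ℝ) (s ρ₀ : ℝ) : Prop :=
  ∃ C : ℝ, ∀ x : E3, ρ₀ ≤ ‖x‖ →
    |f x| ≤ C * ‖x‖ ^ (-s) ∧ (∀ i, |pd f i x| ≤ C * ‖x‖ ^ (-s - 1)) ∧
      ∀ i k, |pd (pd f i) k x| ≤ C * ‖x‖ ^ (-s - 2)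

/-- Integral of `f` over the Euclidean sphere `{‖x‖ = ρ}` with respect to the standard
surface measure (two-dimensional Hausdorff measure). -/
def sphereIntegral (ρ : ℝ) (f : E3 → ℝ) : ℝ :=
  ∫ x in Metric.sphere (0 : E3) ρ, f x ∂(μH[2])

/-- The center-of-mass surface integrand for the metric `g`, component `l`, on the
sphere of radius `ρ`. -/
def ctmIntegral (g : E3 → Matrix (Fin 3) (Fin 3) ℝ) (l : Fin 3) (ρ : ℝ) : ℝ :=
  sphereIntegral ρ (fun x =>
    x l * ∑ i, ∑ j, (pd (fun y => g y i j) i x - pd (fun y => g y i i) j x) * (x j / ρ)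
      - ∑ i, (g x i l * (x i / ρ) - g x i i * (x l / ρ)))

/-- `α(x) = x₁/r`. -/
def α₉ (x : E3) : ℝ := x 0 / ‖x‖

open scoped Topology Pointwise
open Asymptotics Bornology

/-- The standard surface measure of the unit sphere, as a measure on `ℝ³`. -/
def unitSphereMeasure : Measure E3 := (μH[2] : Measure E3).restrict (Metric.sphere (0 : E3) 1)

/-- Spherical coordinates on the unit sphere. -/
def sphericalPoint (p : Fin 2 → ℝ) : E3 :=
  !₂[Real.sin (p 0) * Real.cos (p 1), Real.sin (p 0) * Real.sin (p 1), Real.cos (p 0)]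

theorem abs_mul_sub_mul_le {a b c d t : ℝ} (ha : |a| ≤ 1) (hd : |d| ≤ 1)
    (hac : |a - c| ≤ t) (hbd : |b - d| ≤ t) : |a * b - c * d| ≤ 2 * t := by
  have h : a * b - c * d = a * (b - d) + (a - c) * d := by ring
  rw [h]
  calc |a * (b - d) + (a - c) * d| ≤ |a * (b - d)| + |(a - c) * d| := abs_add_le _ _
    _ = |a| * |b - d| + |a - c| * |d| := by rw [abs_mul, abs_mul]
    _ ≤ 1 * t + t * 1 := by gcongr; exact (abs_nonneg _).trans hac
    _ = 2 * t := by ring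

theorem lipschitzWith_sphericalPoint : LipschitzWith 4 sphericalPoint := by
  refine LipschitzWith.of_dist_le_mul fun p p' => ?_
  have h0 : |p 0 - p' 0| ≤ dist p p' := dist_le_pi_dist p p' 0
  have h1 : |p 1 - p' 1| ≤ dist p p' := dist_le_pi_dist p p' 1
  have s0 : |Real.sin (p 0) - Real.sin (p' 0)| ≤ dist p p' :=
    (Real.abs_sin_sub_sin_le _ _).trans h0
  have c0 : |Real.cos (p 0) - Real.cos (p' 0)| ≤ dist p p' :=
    (Real.abs_cos_sub_cos_le _ _).trans h0
  have s1 : |Real.sin (p 1) - Real.sin (p' 1)| ≤ dist p p' :=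
    (Real.abs_sin_sub_sin_le _ _).trans h1
  have c1 : |Real.cos (p 1) - Real.cos (p' 1)| ≤ dist p p' :=
    (Real.abs_cos_sub_cos_le _ _).trans h1
  have e0 := abs_mul_sub_mul_le (Real.abs_sin_le_one _) (Real.abs_cos_le_one _) s0 c1
  have e1 := abs_mul_sub_mul_le (Real.abs_sin_le_one _) (Real.abs_sin_le_one _) s0 s1
  rw [EuclideanSpace.dist_eq]
  apply Real.sqrt_le_iff.2
  refine ⟨by positivity, ?_⟩
  have hd : 0 ≤ dist p p' := dist_nonneg
  have q0 := sq_le_sq' (by linarith [(abs_le.1 e0).1]) (abs_le.1 e0).2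
  have q1 := sq_le_sq' (by linarith [(abs_le.1 e1).1]) (abs_le.1 e1).2
  have q2 := sq_le_sq' (by linarith [(abs_le.1 c0).1]) (abs_le.1 c0).2
  simp only [sphericalPoint, Fin.sum_univ_three, Real.dist_eq, sq_abs]
  simp only [Matrix.cons_val]
  push_cast
  nlinarith

theorem sphere_subset_image_sphericalPoint :
    Metric.sphere (0 : E3) 1 ⊆
      sphericalPoint '' (Set.Icc (fun _ => -Real.pi) (fun _ => Real.pi)) := by
  intro x hx
  have hx1 : ‖x‖ ^ 2 = 1 := by rw [mem_sphere_zero_iff_norm.1 hx]; norm_num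
  rw [EuclideanSpace.real_norm_sq_eq, Fin.sum_univ_three] at hx1
  set z : ℂ := ⟨x 0, x 1⟩ with hz
  have hzn : ‖z‖ = Real.sqrt (1 - x 2 ^ 2) := by
    rw [Complex.norm_eq_sqrt_sq_add_sq]
    congr 1
    simp only [hz]; linarith
  refine ⟨![Real.arccos (x 2), z.arg], ?_, ?_⟩
  · have := Real.pi_pos
    refine ⟨fun i => ?_, fun i => ?_⟩ <;> fin_cases i
    · simpa using by linarith [Real.arccos_nonneg (x 2)]
    · simpa using (Complex.neg_pi_lt_arg z).le
    · simpa using Real.arccos_le_pi (x 2)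
    · simpa using Complex.arg_le_pi z
  · have hsin : Real.sin (Real.arccos (x 2)) = ‖z‖ := by rw [Real.sin_arccos, hzn]
    have hcos : Real.cos (Real.arccos (x 2)) = x 2 :=
      Real.cos_arccos (by nlinarith [sq_nonneg (x 0), sq_nonneg (x 1)])
        (by nlinarith [sq_nonneg (x 0), sq_nonneg (x 1)])
    ext i
    fin_cases i
    · simp [sphericalPoint, hsin, hz]
    · simp [sphericalPoint, hsin, hz]
    · simp [sphericalPoint, hcos]

instance : IsFiniteMeasure unitSphereMeasure := by
  constructor
  rw [unitSphereMeasure, Measure.restrict_apply_univ]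
  have hvol : (μH[2] : Measure (Fin 2 → ℝ)) = volume := by
    simpa using hausdorffMeasure_pi_real (ι := Fin 2)
  refine (measure_mono sphere_subset_image_sphericalPoint).trans_lt ?_
  refine (lipschitzWith_sphericalPoint.hausdorffMeasure_image_le (by norm_num) _).trans_lt ?_
  rw [hvol]
  refine ENNReal.mul_lt_top (ENNReal.rpow_lt_top_of_nonneg (by norm_num) (by simp)) ?_
  exact isCompact_Icc.measure_lt_top

theorem unitSphereMeasure_univ_ne_zero : unitSphereMeasure Set.univ ≠ 0 := by
  rw [unitSphereMeasure, Measure.restrict_apply_univ]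
  have hvol : (μH[2] : Measure (Fin 2 → ℝ)) = volume := by
    simpa using hausdorffMeasure_pi_real (ι := Fin 2)
  let P : E3 → (Fin 2 → ℝ) := fun x => ![x 0, x 1]
  have hP : LipschitzWith 1 P := by
    refine LipschitzWith.of_dist_le_mul fun x y => ?_
    rw [NNReal.coe_one, one_mul, dist_pi_le_iff dist_nonneg]
    intro i
    fin_cases i
    · simpa [P, dist_eq_norm] using PiLp.norm_apply_le (x - y) 0
    · simpa [P, dist_eq_norm] using PiLp.norm_apply_le (x - y) 1
  have hsub : Set.Icc (fun _ => 0) (fun _ => 1 / 2) ⊆ P '' Metric.sphere (0 : E3) 1 := by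
    intro p hp
    have h0 := hp.1 0
    have h1 := hp.2 0
    have h2 := hp.1 1
    have h3 := hp.2 1
    simp only at h0 h1 h2 h3
    refine ⟨!₂[p 0, p 1, Real.sqrt (1 - p 0 ^ 2 - p 1 ^ 2)], ?_, ?_⟩
    · rw [mem_sphere_zero_iff_norm, EuclideanSpace.norm_eq, Fin.sum_univ_three]
      simp only [Real.norm_eq_abs, sq_abs, Matrix.cons_val]
      rw [Real.sq_sqrt (by nlinarith)]
      simp
    · ext i; fin_cases i <;> simp [P]
  have h := (measure_mono hsub).trans
    (hP.hausdorffMeasure_image_le (by norm_num : (0 : ℝ) ≤ 2) (Metric.sphere (0 : E3) 1))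
  intro h0
  rw [h0, mul_zero, hvol, Real.volume_Icc_pi] at h
  norm_num at h

theorem measurePreserving_unitSphereMeasure (e : E3 ≃ₗᵢ[ℝ] E3) :
    MeasurePreserving e unitSphereMeasure unitSphereMeasure := by
  have h := (e.toIsometryEquiv.measurePreserving_hausdorffMeasure 2).restrict_preimage
    (s := Metric.sphere (0 : E3) 1) Metric.isClosed_sphere.measurableSet
  have hs : e.toIsometryEquiv ⁻¹' Metric.sphere (0 : E3) 1 = Metric.sphere (0 : E3) 1 := by
    ext x; simp
  rw [hs] at h
  exact h

theorem integral_comp_unitSphereMeasure (e : E3 ≃ₗᵢ[ℝ] E3) (f : E3 → ℝ) :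
    ∫ x, f (e x) ∂unitSphereMeasure = ∫ x, f x ∂unitSphereMeasure :=
  (measurePreserving_unitSphereMeasure e).integral_comp
    e.toHomeomorph.measurableEmbedding f

theorem ae_norm_eq_one : ∀ᵐ x ∂unitSphereMeasure, ‖x‖ = 1 := by
  filter_upwards [ae_restrict_mem Metric.isClosed_sphere.measurableSet] with x hx
  exact mem_sphere_zero_iff_norm.1 hx

theorem sphereIntegral_eq {ρ : ℝ} (hρ : 0 < ρ) (f : E3 → ℝ) :
    sphereIntegral ρ f = ρ ^ 2 * ∫ x, f (ρ • x) ∂unitSphereMeasure := by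
  have hmap : (μH[2] : Measure E3).restrict (Metric.sphere (0 : E3) ρ) =
      ENNReal.ofReal (ρ ^ 2) • unitSphereMeasure.map (fun x => ρ • x) := by
    ext s hs
    have hm : Measurable (fun x : E3 => ρ • x) := measurable_const_smul ρ
    rw [Measure.restrict_apply hs, Measure.smul_apply, Measure.map_apply hm hs,
      unitSphereMeasure, Measure.restrict_apply (hm hs)]
    have himg : s ∩ Metric.sphere (0 : E3) ρ =
        ρ • ((fun x : E3 => ρ • x) ⁻¹' s ∩ Metric.sphere (0 : E3) 1) := by
      ext y
      rw [Set.mem_smul_set_iff_inv_smul_mem₀ hρ.ne']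
      simp only [Set.mem_inter_iff, mem_sphere_zero_iff_norm, Set.mem_preimage,
        smul_inv_smul₀ hρ.ne', norm_smul, norm_inv, Real.norm_of_nonneg hρ.le]
      rw [inv_mul_eq_one₀ hρ.ne', eq_comm (a := ρ)]
    rw [himg, Measure.hausdorffMeasure_smul₀ (by norm_num) hρ.ne', ENNReal.smul_def, smul_eq_mul,
      smul_eq_mul]
    congr 1
    rw [ENNReal.ofReal, ENNReal.coe_inj]
    ext
    simp [Real.coe_toNNReal _ (sq_nonneg ρ), abs_of_pos hρ]
  have himap : ∫ x, f x ∂unitSphereMeasure.map (fun x => ρ • x) =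
      ∫ x, f (ρ • x) ∂unitSphereMeasure :=
    (Homeomorph.smulOfNeZero (α := E3) ρ hρ.ne').measurableEmbedding.integral_map f
  rw [sphereIntegral, hmap, integral_smul_measure, himap,
    ENNReal.toReal_ofReal (by positivity), smul_eq_mul]

theorem integrable_unitSphereMeasure {f : E3 → ℝ} (hf : ContinuousOn f (Metric.sphere 0 1)) :
    Integrable f unitSphereMeasure := by
  have hfin : (μH[2] : Measure E3) (Metric.sphere (0 : E3) 1) ≠ ⊤ := by
    have := measure_ne_top unitSphereMeasure Set.univ
    rwa [unitSphereMeasure, Measure.restrict_apply_univ] at this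
  obtain ⟨C, hC⟩ := (isCompact_sphere (0 : E3) 1).exists_bound_of_continuousOn hf
  refine Integrable.mono' (integrable_const C)
    (hf.aestronglyMeasurable Metric.isClosed_sphere.measurableSet) ?_
  filter_upwards [ae_restrict_mem Metric.isClosed_sphere.measurableSet] with x hx using hC x hx

theorem integral_coord_sq_pos (i : Fin 3) : 0 < ∫ x : E3, x i ^ 2 ∂unitSphereMeasure := by
  have hperm : ∀ j, ∫ x : E3, x j ^ 2 ∂unitSphereMeasure =
      ∫ x : E3, x i ^ 2 ∂unitSphereMeasure := by
    intro j
    have := integral_comp_unitSphereMeasure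
      (LinearIsometryEquiv.piLpCongrLeft 2 ℝ ℝ (Equiv.swap i j)) (fun x => x i ^ 2)
    simpa [LinearIsometryEquiv.piLpCongrLeft_apply, Equiv.piCongrLeft'] using this
  have hInt : ∀ j, Integrable (fun x : E3 => x j ^ 2) unitSphereMeasure := fun j =>
    integrable_unitSphereMeasure (by fun_prop)
  have hsum : ∑ j, ∫ x : E3, x j ^ 2 ∂unitSphereMeasure = unitSphereMeasure.real Set.univ := by
    rw [← integral_finsetSum _ fun j _ => hInt j]
    rw [integral_congr_ae (g := fun _ => (1 : ℝ))]
    · simp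
    · filter_upwards [ae_norm_eq_one] with x hx
      rw [← EuclideanSpace.real_norm_sq_eq, hx, one_pow]
  simp only [hperm, Finset.sum_const, Finset.card_univ, Fintype.card_fin, nsmul_eq_mul] at hsum
  have hpos : 0 < unitSphereMeasure.real Set.univ :=
    ENNReal.toReal_pos unitSphereMeasure_univ_ne_zero (measure_ne_top _ _)
  push_cast at hsum
  linarith

/-- `f` is differentiable at `x`, and its partial derivatives there are the given ones. -/
def HasPD (f : E3 → ℝ) (f' : Fin 3 → ℝ) (x : E3) : Prop :=
  DifferentiableAt ℝ f x ∧ ∀ k, pd f k x = f' k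

namespace HasPD

variable {f g : E3 → ℝ} {f' g' : Fin 3 → ℝ} {x : E3}

theorem of_differentiableAt (hf : DifferentiableAt ℝ f x) : HasPD f (fun k => pd f k x) x :=
  ⟨hf, fun _ => rfl⟩

theorem congr_deriv (hf : HasPD f f' x) (h : ∀ k, f' k = g' k) : HasPD f g' x :=
  ⟨hf.1, fun k => (hf.2 k).trans (h k)⟩

theorem congr_of_eventuallyEq (hf : HasPD f f' x) (h : g =ᶠ[𝓝 x] f) : HasPD g f' x :=
  ⟨hf.1.congr_of_eventuallyEq h, fun k => by rw [pd, h.fderiv_eq]; exact hf.2 k⟩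

theorem const (c : ℝ) : HasPD (fun _ => c) (fun _ => 0) x :=
  ⟨differentiableAt_const c, fun k => by simp [pd]⟩

theorem coord (i : Fin 3) : HasPD (fun y => y i) (fun k => kron i k) x := by
  have h : HasFDerivAt (fun y : E3 => y i) (EuclideanSpace.proj i : E3 →L[ℝ] ℝ) x :=
    (EuclideanSpace.proj i : E3 →L[ℝ] ℝ).hasFDerivAt
  refine ⟨h.differentiableAt, fun k => ?_⟩
  rw [pd, h.fderiv]
  simp [kron]

theorem add (hf : HasPD f f' x) (hg : HasPD g g' x) :
    HasPD (fun y => f y + g y) (fun k => f' k + g' k) x :=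
  ⟨hf.1.add hg.1, fun k => by
    rw [pd, fderiv_fun_add hf.1 hg.1]; exact congrArg₂ (· + ·) (hf.2 k) (hg.2 k)⟩

theorem sub (hf : HasPD f f' x) (hg : HasPD g g' x) :
    HasPD (fun y => f y - g y) (fun k => f' k - g' k) x :=
  ⟨hf.1.sub hg.1, fun k => by
    rw [pd, fderiv_fun_sub hf.1 hg.1]; exact congrArg₂ (· - ·) (hf.2 k) (hg.2 k)⟩

theorem mul (hf : HasPD f f' x) (hg : HasPD g g' x) :
    HasPD (fun y => f y * g y) (fun k => f x * g' k + g x * f' k) x :=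
  ⟨hf.1.mul hg.1, fun k => by
    rw [pd, fderiv_fun_mul hf.1 hg.1]
    exact congrArg₂ (fun a b => f x * a + g x * b) (hg.2 k) (hf.2 k)⟩

theorem const_mul (c : ℝ) (hf : HasPD f f' x) :
    HasPD (fun y => c * f y) (fun k => c * f' k) x :=
  ((const c).mul hf).congr_deriv fun k => by ring

theorem pow (hf : HasPD f f' x) (n : ℕ) :
    HasPD (fun y => f y ^ (n + 1)) (fun k => (n + 1) * f x ^ n * f' k) x := by
  induction n with
  | zero => simpa using hf
  | succ n ih =>
    have h := (ih.mul hf).congr_deriv (g' := fun k => ((n + 1 : ℕ) + 1) * f x ^ (n + 1) * f' k)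
      fun k => by push_cast; ring
    simpa only [← pow_succ] using h

theorem sum {ι : Type*} {s : Finset ι} {F : ι → E3 → ℝ} {F' : ι → Fin 3 → ℝ}
    (h : ∀ i ∈ s, HasPD (F i) (F' i) x) :
    HasPD (fun y => ∑ i ∈ s, F i y) (fun k => ∑ i ∈ s, F' i k) x := by
  classical
  induction s using Finset.induction_on with
  | empty => simpa using const 0
  | insert a s ha ih =>
    simp only [Finset.sum_insert ha]
    exact (h a (Finset.mem_insert_self a s)).add
      (ih fun i hi => h i (Finset.mem_insert_of_mem hi))

theorem norm_inv (hx : x ≠ 0) : HasPD (fun y => ‖y‖⁻¹) (fun k => -x k * ‖x‖⁻¹ ^ 3) x := by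
  have hn : ‖x‖ ≠ 0 := norm_ne_zero_iff.2 hx
  have hd : DifferentiableAt ℝ (fun y : E3 => ‖y‖) x := (contDiffAt_norm ℝ hx).differentiableAt
    one_ne_zero
  have hsq : HasPD (fun y : E3 => ‖y‖ ^ 2) (fun k => 2 * x k) x := by
    have h : HasPD (fun y : E3 => ∑ i, y i ^ (1 + 1))
        (fun k => ∑ i, ((1 : ℕ) + 1) * x i ^ 1 * kron i k) x :=
      HasPD.sum fun i _ => (coord i).pow 1
    have h2 : (fun y : E3 => ‖y‖ ^ 2) = fun y : E3 => ∑ i, y i ^ (1 + 1) := by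
      funext y; rw [EuclideanSpace.real_norm_sq_eq]
    rw [h2]
    refine h.congr_deriv fun k => ?_
    simp only [kron, mul_ite, mul_one, mul_zero, Finset.sum_ite_eq', Finset.mem_univ, if_true]
    norm_num
  have hpn : ∀ k, pd (fun y : E3 => ‖y‖) k x = x k / ‖x‖ := fun k => by
    have h1 := ((of_differentiableAt hd).pow 1).2 k
    have h2 := hsq.2 k
    norm_num at h1
    rw [h1] at h2
    field_simp
    linarith
  have hdi : DifferentiableAt ℝ (fun y : E3 => ‖y‖⁻¹) x := hd.inv hn
  refine ⟨hdi, fun k => ?_⟩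
  have h1 : (fun y : E3 => ‖y‖ * ‖y‖⁻¹) =ᶠ[𝓝 x] fun _ => 1 := by
    filter_upwards [isOpen_ne.mem_nhds hx] with y hy
    exact mul_inv_cancel₀ (norm_ne_zero_iff.2 hy)
  have h2 := (((of_differentiableAt hd).mul (of_differentiableAt hdi)).2 k).symm.trans
    (((const (x := x) 1).congr_of_eventuallyEq h1).2 k)
  simp only [hpn] at h2
  field_simp at h2 ⊢
  linarith

end HasPD

theorem fderiv_apply_eq_sum_pd (f : E3 → ℝ) (x v : E3) :
    fderiv ℝ f x v = ∑ i, v i * pd f i x := by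
  have hv : v = ∑ i, v i • EuclideanSpace.single i (1 : ℝ) := by
    ext j; simp [Pi.single_apply]
  conv_lhs => rw [hv]
  simp [pd]

theorem continuousOn_pd {f : E3 → ℝ} {U : Set E3} (hU : IsOpen U) (hf : ContDiffOn ℝ 1 f U)
    (i : Fin 3) : ContinuousOn (pd f i) U :=
  (hf.continuousOn_fderiv_of_isOpen hU le_rfl).clm_apply continuousOn_const

theorem contDiffOn_pd {f : E3 → ℝ} {U : Set E3} (hU : IsOpen U) (hf : ContDiffOn ℝ 2 f U)
    (i : Fin 3) : ContDiffOn ℝ 1 (pd f i) U :=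
  (hf.fderiv_of_isOpen hU (by norm_num)).clm_apply contDiffOn_const

theorem isOpen_exterior (ρ₀ : ℝ) : IsOpen {x : E3 | ρ₀ < ‖x‖} :=
  isOpen_lt continuous_const continuous_norm

theorem hasDerivAt_integral_unitSphereMeasure {F F' : ℝ → E3 → ℝ} {t₀ : ℝ} {s : Set ℝ}
    (hs : s ∈ 𝓝 t₀) (hF : ∀ t ∈ s, ContinuousOn (F t) (Metric.sphere 0 1))
    (hF' : ContinuousOn (fun p : ℝ × E3 => F' p.1 p.2) (s ×ˢ Metric.sphere 0 1))
    (hd : ∀ t ∈ s, ∀ x ∈ Metric.sphere (0 : E3) 1, HasDerivAt (F · x) (F' t x) t) :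
    HasDerivAt (fun t => ∫ x, F t x ∂unitSphereMeasure) (∫ x, F' t₀ x ∂unitSphereMeasure) t₀ := by
  obtain ⟨K, hK, hKs, hKc⟩ := local_compact_nhds hs
  obtain ⟨C, hC⟩ := (hKc.prod (isCompact_sphere (0 : E3) 1)).exists_bound_of_continuousOn
    (hF'.mono (Set.prod_mono hKs le_rfl))
  have hmem : ∀ᵐ x ∂unitSphereMeasure, x ∈ Metric.sphere (0 : E3) 1 :=
    ae_restrict_mem Metric.isClosed_sphere.measurableSet
  have hF't : ContinuousOn (F' t₀) (Metric.sphere 0 1) :=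
    hF'.comp (by fun_prop : ContinuousOn (fun x : E3 => (t₀, x)) _)
      fun x hx => ⟨mem_of_mem_nhds hs, hx⟩
  refine (hasDerivAt_integral_of_dominated_loc_of_deriv_le (bound := fun _ => C) hK ?_ ?_ ?_ ?_
    (integrable_const C) ?_).2
  · filter_upwards [hs] with t ht
    exact (integrable_unitSphereMeasure (hF t ht)).aestronglyMeasurable
  · exact integrable_unitSphereMeasure (hF t₀ (mem_of_mem_nhds hs))
  · exact (integrable_unitSphereMeasure hF't).aestronglyMeasurable
  · filter_upwards [hmem] with x hx t ht using hC (t, x) ⟨ht, hx⟩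
  · filter_upwards [hmem] with x hx t ht using hd t (hKs ht) x hx

/-- The orthogonal projection to the `k`-th coordinate axis. -/
def axisProj (k : Fin 3) : E3 →L[ℝ] E3 :=
  (EuclideanSpace.proj k : E3 →L[ℝ] ℝ).smulRight (EuclideanSpace.single k 1)

/-- The generator `x ↦ e_k × x` of the rotations about the `k`-th coordinate axis. -/
def rotGen (k : Fin 3) : E3 →L[ℝ] E3 :=
  (EuclideanSpace.proj (k + 1) : E3 →L[ℝ] ℝ).smulRight (EuclideanSpace.single (k + 2) 1) -
    (EuclideanSpace.proj (k + 2) : E3 →L[ℝ] ℝ).smulRight (EuclideanSpace.single (k + 1) 1)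

/-- The rotation by the angle `t` about the `k`-th coordinate axis. -/
def rotMap (k : Fin 3) (t : ℝ) : E3 →L[ℝ] E3 :=
  axisProj k + Real.cos t • (ContinuousLinearMap.id ℝ E3 - axisProj k) + Real.sin t • rotGen k

theorem norm_rotMap (k : Fin 3) (t : ℝ) (x : E3) : ‖rotMap k t x‖ = ‖x‖ := by
  have h := Real.sin_sq_add_cos_sq t
  rw [EuclideanSpace.norm_eq, EuclideanSpace.norm_eq]
  congr 1
  simp only [Real.norm_eq_abs, sq_abs, Fin.sum_univ_three]
  fin_cases k <;> simp [rotMap, rotGen, axisProj] <;> grind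

theorem rotMap_zero (k : Fin 3) (x : E3) : rotMap k 0 x = x := by
  simp [rotMap]

theorem hasDerivAt_rotMap (k : Fin 3) (t : ℝ) (x : E3) :
    HasDerivAt (fun t => rotMap k t x)
      ((-Real.sin t) • (x - axisProj k x) + Real.cos t • rotGen k x) t := by
  have h := (((Real.hasDerivAt_cos t).smul_const (x - axisProj k x)).const_add (axisProj k x)).add
    ((Real.hasDerivAt_sin t).smul_const (rotGen k x))
  exact h

/-- The rotation by the angle `t` about the `k`-th coordinate axis, as an isometry. -/
def rotIso (k : Fin 3) (t : ℝ) : E3 ≃ₗᵢ[ℝ] E3 :=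
  LinearIsometry.toLinearIsometryEquiv ⟨(rotMap k t).toLinearMap, norm_rotMap k t⟩ rfl

theorem integral_fderiv_rotGen_eq_zero {f : E3 → ℝ} {ρ₀ ρ : ℝ}
    (hf : ContDiffOn ℝ 1 f {x : E3 | ρ₀ < ‖x‖}) (hρ₀ : 0 ≤ ρ₀) (hρ : ρ₀ < ρ) (k : Fin 3) :
    ∫ x, fderiv ℝ f (ρ • x) (rotGen k (ρ • x)) ∂unitSphereMeasure = 0 := by
  have hρ' : 0 < ρ := hρ₀.trans_lt hρ
  have hmem : ∀ t, ∀ x ∈ Metric.sphere (0 : E3) 1, ρ • rotMap k t x ∈ {x : E3 | ρ₀ < ‖x‖} := by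
    intro t x hx
    rw [mem_sphere_zero_iff_norm] at hx
    simpa [norm_smul, norm_rotMap, hx, abs_of_pos hρ'] using hρ
  have hcont : Continuous fun p : ℝ × E3 => rotMap k p.1 p.2 := by
    simp only [rotMap]; fun_prop
  have h := hasDerivAt_integral_unitSphereMeasure (t₀ := 0) (s := Set.univ)
    (F := fun t x => f (ρ • rotMap k t x))
    (F' := fun t x => fderiv ℝ f (ρ • rotMap k t x)
      (ρ • ((-Real.sin t) • (x - axisProj k x) + Real.cos t • rotGen k x))) univ_mem
    (fun t _ => hf.continuousOn.comp (by fun_prop) (hmem t))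
    (by
      refine ContinuousOn.clm_apply ?_ (by fun_prop)
      refine (hf.continuousOn_fderiv_of_isOpen (isOpen_exterior ρ₀) le_rfl).comp
        (hcont.const_smul ρ).continuousOn ?_
      rintro ⟨t, x⟩ ⟨-, hx⟩
      exact hmem t x hx)
    (fun t _ x hx => by
      have hfd := ((hf.contDiffAt ((isOpen_exterior ρ₀).mem_nhds (hmem t x hx))).differentiableAt
        one_ne_zero).hasFDerivAt
      exact hfd.comp_hasDerivAt t ((hasDerivAt_rotMap k t x).const_smul ρ))
  have hconst : (fun t => ∫ x, f (ρ • rotMap k t x) ∂unitSphereMeasure) =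
      fun _ => ∫ x, f (ρ • x) ∂unitSphereMeasure := by
    funext t
    exact integral_comp_unitSphereMeasure (rotIso k t) (fun x => f (ρ • x))
  rw [hconst] at h
  have h0 := h.unique (hasDerivAt_const _ _)
  simpa [rotMap_zero] using h0

/-- The `k`-th component of the cross product of the position vector with `V`. -/
def positionCross (V : Fin 3 → E3 → ℝ) (k : Fin 3) (x : E3) : ℝ :=
  x (k + 1) * V (k + 2) x - x (k + 2) * V (k + 1) x

theorem sum_fderiv_positionCross {V : Fin 3 → E3 → ℝ} {x : E3}
    (hV : ∀ j, DifferentiableAt ℝ (V j) x) :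
    ∑ k, fderiv ℝ (positionCross V k) x (rotGen k x) =
      ‖x‖ ^ 2 * ∑ j, pd (V j) j x - 2 * ∑ j, V j x * x j
        - ∑ j, (∑ i, x i * pd (V j) i x) * x j := by
  have hpd : ∀ k i, pd (positionCross V k) i x =
      x (k + 1) * pd (V (k + 2)) i x + V (k + 2) x * kron (k + 1) i
        - (x (k + 2) * pd (V (k + 1)) i x + V (k + 1) x * kron (k + 2) i) := fun k i =>
    (((HasPD.coord (k + 1)).mul (.of_differentiableAt (hV (k + 2)))).sub
      ((HasPD.coord (k + 2)).mul (.of_differentiableAt (hV (k + 1))))).2 i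
  rw [EuclideanSpace.real_norm_sq_eq]
  simp only [fderiv_apply_eq_sum_pd, hpd]
  simp [Fin.sum_univ_three, rotGen, kron]
  ring

theorem hasDerivAt_flux {V : Fin 3 → E3 → ℝ} {ρ₀ ρ : ℝ}
    (hV : ∀ j, ContDiffOn ℝ 1 (V j) {x : E3 | ρ₀ < ‖x‖}) (hρ₀ : 0 ≤ ρ₀) (hρ : ρ₀ < ρ) :
    HasDerivAt (fun ρ : ℝ => ρ ^ 2 * ∫ x, ∑ j, V j (ρ • x) * x j ∂unitSphereMeasure)
      (ρ ^ 2 * ∫ x, ∑ j, pd (V j) j (ρ • x) ∂unitSphereMeasure) ρ := by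
  have hmem : ∀ t ∈ Set.Ioi ρ₀, ∀ x ∈ Metric.sphere (0 : E3) 1, t • x ∈ {x : E3 | ρ₀ < ‖x‖} := by
    intro t ht x hx
    rw [mem_sphere_zero_iff_norm] at hx
    simpa [norm_smul, hx, abs_of_pos (hρ₀.trans_lt ht)] using ht
  have hU := isOpen_exterior ρ₀
  have hdiff : ∀ x ∈ {x : E3 | ρ₀ < ‖x‖}, ∀ j, DifferentiableAt ℝ (V j) x := fun x hx j =>
    ((hV j).contDiffAt (hU.mem_nhds hx)).differentiableAt one_ne_zero
  have hsm : ∀ t ∈ Set.Ioi ρ₀, ∀ f : E3 → ℝ, ContinuousOn f {x : E3 | ρ₀ < ‖x‖} →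
      ContinuousOn (fun x => f (t • x)) (Metric.sphere 0 1) := fun t ht f hf =>
    hf.comp (by fun_prop) (hmem t ht)
  have hpc : ∀ j i, ContinuousOn (pd (V j) i) {x : E3 | ρ₀ < ‖x‖} := fun j i =>
    continuousOn_pd hU (hV j) i
  have h := hasDerivAt_integral_unitSphereMeasure (t₀ := ρ) (s := Set.Ioi ρ₀)
    (F := fun t x => ∑ j, V j (t • x) * x j)
    (F' := fun t x => ∑ j, (∑ i, x i * pd (V j) i (t • x)) * x j) (Ioi_mem_nhds hρ)
    (fun t ht => by
      refine continuousOn_finsetSum _ fun j _ => ?_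
      exact (hsm t ht _ (hV j).continuousOn).mul (by fun_prop))
    (by
      refine continuousOn_finsetSum _ fun j _ => ContinuousOn.mul ?_ (by fun_prop)
      refine continuousOn_finsetSum _ fun i _ => ContinuousOn.mul (by fun_prop) ?_
      refine (hpc j i).comp (by fun_prop) ?_
      rintro ⟨t, x⟩ ⟨ht, hx⟩
      exact hmem t ht x hx)
    (fun t ht x hx => by
      refine HasDerivAt.fun_sum fun j _ => HasDerivAt.mul_const ?_ _
      rw [← fderiv_apply_eq_sum_pd]
      have h1 : HasDerivAt (fun t : ℝ => t • x) x t := by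
        simpa using (hasDerivAt_id t).smul_const x
      exact ((hdiff _ (hmem t ht x hx) j).hasFDerivAt).comp_hasDerivAt t h1)
  have h2 := (hasDerivAt_pow 2 ρ).mul h
  refine h2.congr_deriv ?_
  have hρ' : 0 < ρ := hρ₀.trans_lt hρ
  have hWc : ∀ k, ContDiffOn ℝ 1 (positionCross V k) {x : E3 | ρ₀ < ‖x‖} := fun k => by
    have hc : ∀ i : Fin 3, ContDiff ℝ 1 fun x : E3 => x i := fun i => by fun_prop
    exact ((hc _).contDiffOn.mul (hV _)).sub ((hc _).contDiffOn.mul (hV _))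
  have hz : ∫ x, ∑ k, fderiv ℝ (positionCross V k) (ρ • x) (rotGen k (ρ • x)) ∂unitSphereMeasure
      = 0 := by
    rw [integral_finsetSum]
    · exact Finset.sum_eq_zero fun k _ => integral_fderiv_rotGen_eq_zero (hWc k) hρ₀ hρ k
    · intro k _
      refine integrable_unitSphereMeasure (ContinuousOn.clm_apply ?_ (by fun_prop))
      exact ((hWc k).continuousOn_fderiv_of_isOpen hU le_rfl).comp (by fun_prop) (hmem ρ hρ)
  have hi1 : Integrable (fun x : E3 => ∑ j, V j (ρ • x) * x j) unitSphereMeasure :=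
    integrable_unitSphereMeasure <| continuousOn_finsetSum _ fun j _ =>
      (hsm ρ hρ _ (hV j).continuousOn).mul (by fun_prop)
  have hi2 : Integrable (fun x : E3 => ∑ j, (∑ i, x i * pd (V j) i (ρ • x)) * x j)
      unitSphereMeasure :=
    integrable_unitSphereMeasure <| continuousOn_finsetSum _ fun j _ =>
      (continuousOn_finsetSum _ fun i _ =>
        ContinuousOn.mul (by fun_prop) (hsm ρ hρ _ (hpc j i))).mul (by fun_prop)
  have hi3 : Integrable (fun x : E3 => ∑ j, pd (V j) j (ρ • x)) unitSphereMeasure :=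
    integrable_unitSphereMeasure <| continuousOn_finsetSum _ fun j _ => hsm ρ hρ _ (hpc j j)
  have hpt : ∀ᵐ x ∂unitSphereMeasure,
      ∑ k, fderiv ℝ (positionCross V k) (ρ • x) (rotGen k (ρ • x)) =
        ρ ^ 2 * ∑ j, pd (V j) j (ρ • x) - (2 * ρ) * ∑ j, V j (ρ • x) * x j
          - ρ ^ 2 * ∑ j, (∑ i, x i * pd (V j) i (ρ • x)) * x j := by
    filter_upwards [ae_norm_eq_one] with x hx
    rw [sum_fderiv_positionCross
      (hdiff _ (hmem ρ hρ x (mem_sphere_zero_iff_norm.2 hx)))]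
    simp only [norm_smul, hx, Real.norm_of_nonneg hρ'.le, PiLp.smul_apply, smul_eq_mul,
      Fin.sum_univ_three]
    ring
  have hi31 : Integrable (fun x : E3 => ρ ^ 2 * ∑ j, pd (V j) j (ρ • x)
      - (2 * ρ) * ∑ j, V j (ρ • x) * x j) unitSphereMeasure :=
    (hi3.const_mul _).sub (hi1.const_mul _)
  rw [integral_congr_ae hpt, integral_sub hi31 (hi2.const_mul _),
    integral_sub (hi3.const_mul _) (hi1.const_mul _), integral_const_mul,
    integral_const_mul, integral_const_mul] at hz
  push_cast
  linarith

/-- Twice the lowered Christoffel symbols `∂_j g_{il} + ∂_i g_{jl} − ∂_l g_{ij}` in terms of the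
first derivatives `D i l j = ∂_j g_{il}`. -/
def chr (D : Fin 3 → Fin 3 → Fin 3 → ℝ) (i j l : Fin 3) : ℝ := D i l j + D j l i - D i j l

/-- The `m`-th partial derivative of `chr` in terms of second derivatives. -/
def dchr (H : Fin 3 → Fin 3 → Fin 3 → Fin 3 → ℝ) (i j l m : Fin 3) : ℝ :=
  H i l j m + H j l i m - H i j l m

/-- Christoffel symbols in terms of the inverse metric `G` and the first derivatives `D`. -/
def gam (G : Fin 3 → Fin 3 → ℝ) (D : Fin 3 → Fin 3 → Fin 3 → ℝ) (k i j : Fin 3) : ℝ :=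
  (1 / 2) * ∑ l, G k l * chr D i j l

/-- The part of the scalar curvature which is quadratic in first derivatives. -/
def quadForm (G : Fin 3 → Fin 3 → ℝ) (dG D : Fin 3 → Fin 3 → Fin 3 → ℝ) : ℝ :=
  ∑ i, ∑ k, G i k *
    ((∑ j, ((1 / 2) * ∑ l, dG j l j * chr D i k l - (1 / 2) * ∑ l, dG j l i * chr D j k l))
      + ∑ j, ∑ m, (gam G D m i k * gam G D j j m - gam G D m j k * gam G D j i m))

/-- The part of the scalar curvature which is linear in second derivatives, with the coefficient
`g^{ik} g^{jl}` replaced by `P i k j l`. -/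
def secForm (P H : Fin 3 → Fin 3 → Fin 3 → Fin 3 → ℝ) : ℝ :=
  ∑ i, ∑ k, ∑ j, ∑ l, P i k j l * ((1 / 2) * (dchr H i k l j - dchr H j k l i))

/-- The scalar curvature linearized at the flat metric. -/
def linForm (H : Fin 3 → Fin 3 → Fin 3 → Fin 3 → ℝ) : ℝ := ∑ i, ∑ j, (H i j i j - H i i j j)

/-- The second-order part of the scalar curvature at the flat metric in terms of the derivatives
of order at most two of the perturbation. -/
def secondVariation (h : Fin 3 → Fin 3 → ℝ) (D : Fin 3 → Fin 3 → Fin 3 → ℝ)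
    (H : Fin 3 → Fin 3 → Fin 3 → Fin 3 → ℝ) : ℝ :=
  secForm (fun i k j l => -h i k * kron j l + kron i k * -h j l) H
    + quadForm kron (fun a b m => -D a b m) D

theorem secForm_kron {H : Fin 3 → Fin 3 → Fin 3 → Fin 3 → ℝ}
    (hH : ∀ i j k l, H i j k l = H j i k l) :
    secForm (fun i k j l => kron i k * kron j l) H = linForm H := by
  simp only [secForm, linForm, dchr, Fin.sum_univ_three, kron]
  simp only [Fin.isValue, hH 1 0, hH 2 0, hH 2 1, Fin.reduceEq, if_true, if_false, one_mul,
    zero_mul, mul_one, mul_zero, zero_add, add_zero]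
  ring

theorem secForm_perturb (h : Fin 3 → Fin 3 → ℝ) (H : Fin 3 → Fin 3 → Fin 3 → Fin 3 → ℝ) :
    secForm (fun i k j l => -h i k * kron j l + kron i k * -h j l) H =
      -(1 / 2) * ∑ i, ∑ k, h i k * ∑ j, ((dchr H i k j j - dchr H j k j i) +
        (dchr H j j k i - dchr H i j k j)) := by
  simp only [secForm, Fin.sum_univ_three, kron]
  simp only [Fin.isValue, Fin.reduceEq, if_true, if_false, one_mul, zero_mul,
    mul_one, mul_zero, zero_add, add_zero]
  ring

theorem gam_kron (D : Fin 3 → Fin 3 → Fin 3 → ℝ) (k i j : Fin 3) :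
    gam kron D k i j = (1 / 2) * chr D i j k := by
  simp [gam, kron]

theorem quadForm_kron (dG D : Fin 3 → Fin 3 → Fin 3 → ℝ) :
    quadForm kron dG D = ∑ i, ∑ j, ∑ l,
      ((1 / 2) * (dG j l j * chr D i i l - dG j l i * chr D j i l)
        + (1 / 4) * (chr D i i l * chr D j l j - chr D j i l * chr D i l j)) := by
  have h : ∀ (F : Fin 3 → ℝ) i, ∑ k, kron i k * F k = F i := fun F i => by simp [kron]
  simp only [quadForm, gam_kron, h]
  refine Finset.sum_congr rfl fun i _ => ?_
  rw [← Finset.sum_add_distrib]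
  refine Finset.sum_congr rfl fun j _ => ?_
  simp only [Fin.sum_univ_three]
  ring

theorem secondVariation_neg (h : Fin 3 → Fin 3 → ℝ) (D : Fin 3 → Fin 3 → Fin 3 → ℝ)
    (H : Fin 3 → Fin 3 → Fin 3 → Fin 3 → ℝ) :
    secondVariation (fun i j => -h i j) D (fun i j k l => -H i j k l) = secondVariation h D H := by
  rw [secondVariation, secondVariation, secForm_perturb, secForm_perturb]
  congr 2
  refine Finset.sum_congr rfl fun i _ => Finset.sum_congr rfl fun k _ => ?_
  simp only [dchr, Fin.sum_univ_three]
  ring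

theorem secForm_conformal (w : ℝ) (w₂ : Fin 3 → Fin 3 → ℝ) (S : Fin 3 → Fin 3 → ℝ)
    (S₂ : Fin 3 → Fin 3 → Fin 3 → Fin 3 → ℝ) (hw₂ : ∀ i j, w₂ i j = w₂ j i)
    (hS : ∀ i j, S i j = S j i) (hS₂ : ∀ i j k l, S₂ i j k l = S₂ j i k l)
    (hS₂' : ∀ i j k l, S₂ i j k l = S₂ i j l k) :
    secForm (fun i k j l => -(w * kron i k + S i k) * kron j l
        + kron i k * -(w * kron j l + S j l)) (fun i j k l => w₂ k l * kron i j + S₂ i j k l)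
      - secForm (fun i k j l => -(-w * kron i k + S i k) * kron j l
        + kron i k * -(-w * kron j l + S j l)) (fun i j k l => -w₂ k l * kron i j + S₂ i j k l) =
    2 * ((∑ i, ∑ j, S i j * w₂ i j) + (∑ j, w₂ j j) * ∑ i, S i i - 2 * w * linForm S₂) := by
  rw [secForm_perturb (fun i k => w * kron i k + S i k),
    secForm_perturb (fun i k => -w * kron i k + S i k)]
  simp only [linForm, dchr, Fin.sum_univ_three, kron]
  simp only [Fin.isValue, Fin.reduceEq, if_true, if_false, mul_one, mul_zero,
    zero_add, hS 1 0, hS 2 0, hS 2 1, hw₂ 1 0, hw₂ 2 0, hw₂ 2 1,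
    hS₂ 1 0, hS₂ 2 0, hS₂ 2 1, hS₂' _ _ 1 0, hS₂' _ _ 2 0, hS₂' _ _ 2 1]
  ring

theorem quadForm_conformal (w₁ : Fin 3 → ℝ) (S₁ : Fin 3 → Fin 3 → Fin 3 → ℝ)
    (hS₁ : ∀ i j k, S₁ i j k = S₁ j i k) :
    quadForm kron (fun i j k => -(w₁ k * kron i j + S₁ i j k))
        (fun i j k => w₁ k * kron i j + S₁ i j k)
      - quadForm kron (fun i j k => -(-w₁ k * kron i j + S₁ i j k))
        (fun i j k => -w₁ k * kron i j + S₁ i j k) =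
    2 * ∑ j, w₁ j * ∑ i, S₁ i i j := by
  rw [quadForm_kron, quadForm_kron]
  simp only [chr, Fin.sum_univ_three, kron]
  simp only [Fin.isValue, Fin.reduceEq, if_true, if_false, mul_one, mul_zero,
    zero_add, hS₁ 1 0, hS₁ 2 0, hS₁ 2 1]
  ring

/-- Gradient of `1 / r`, where `s` stands for `1 / r`. -/
def radialD (s : ℝ) (x : E3) (k : Fin 3) : ℝ := -x k * s ^ 3

/-- Hessian of `1 / r`, where `s` stands for `1 / r`. -/
def radialHess (s : ℝ) (x : E3) (k l : Fin 3) : ℝ := -kron k l * s ^ 3 + 3 * x k * x l * s ^ 5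

/-- The perturbation `σ`, where `s` stands for `1 / r`. -/
def sigmaH (s : ℝ) (x : E3) (i j : Fin 3) : ℝ :=
  x 0 * x i * x j * s ^ 4 - (1 / 2) * kron i j * (x 0 * s ^ 2)

/-- First derivatives of `σ`, where `s` stands for `1 / r`. -/
def sigmaD (s : ℝ) (x : E3) (i j k : Fin 3) : ℝ :=
  (kron 0 k * x i * x j + x 0 * kron i k * x j + x 0 * x i * kron j k) * s ^ 4
    - 4 * (x 0 * x i * x j * x k) * s ^ 6
    - (1 / 2) * kron i j * (kron 0 k * s ^ 2 - 2 * (x 0 * x k) * s ^ 4)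

/-- Second derivatives of `σ`, where `s` stands for `1 / r`. -/
def sigmaHess (s : ℝ) (x : E3) (i j k l : Fin 3) : ℝ :=
  (kron 0 k * (kron i l * x j + x i * kron j l) + kron i k * (kron 0 l * x j + x 0 * kron j l)
      + kron j k * (kron 0 l * x i + x 0 * kron i l)) * s ^ 4
    - 4 * x l * (kron 0 k * x i * x j + x 0 * kron i k * x j + x 0 * x i * kron j k) * s ^ 6
    - 4 * (kron 0 l * x i * x j * x k + x 0 * kron i l * x j * x k + x 0 * x i * kron j l * x k
      + x 0 * x i * x j * kron k l) * s ^ 6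
    + 24 * (x 0 * x i * x j * x k * x l) * s ^ 8
    - (1 / 2) * kron i j * (-2 * kron 0 k * x l * s ^ 4 - 2 * kron 0 l * x k * s ^ 4
      - 2 * x 0 * kron k l * s ^ 4 + 8 * (x 0 * x k * x l) * s ^ 6)

/-- The leading perturbation `(A / r) δ + σ` of the flat metric. -/
def modelH (A s : ℝ) (x : E3) (i j : Fin 3) : ℝ := A * s * kron i j + sigmaH s x i j

/-- First derivatives of the leading perturbation. -/
def modelD (A s : ℝ) (x : E3) (i j k : Fin 3) : ℝ :=
  A * radialD s x k * kron i j + sigmaD s x i j k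

/-- Second derivatives of the leading perturbation. -/
def modelHess (A s : ℝ) (x : E3) (i j k l : Fin 3) : ℝ :=
  A * radialHess s x k l * kron i j + sigmaHess s x i j k l

theorem kron_comm (i j : Fin 3) : kron i j = kron j i := by
  simp only [kron, eq_comm]

theorem hasPD_modelH (A : ℝ) (i j : Fin 3) {x : E3} (hx : x ≠ 0) :
    HasPD (fun y => modelH A ‖y‖⁻¹ y i j) (modelD A ‖x‖⁻¹ x i j) x := by
  have hs := HasPD.norm_inv hx
  have hc := fun i => HasPD.coord (x := x) i
  have h := ((hs.const_mul A).mul (.const (kron i j))).add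
    (((((hc 0).mul (hc i)).mul (hc j)).mul (hs.pow 3)).sub
      (((hc 0).mul (hs.pow 1)).const_mul ((1 / 2) * kron i j)))
  refine h.congr_deriv fun k => ?_
  simp only [modelD, radialD, sigmaD]
  push_cast
  ring

theorem hasPD_modelD (A : ℝ) (i j k : Fin 3) {x : E3} (hx : x ≠ 0) :
    HasPD (fun y => modelD A ‖y‖⁻¹ y i j k) (modelHess A ‖x‖⁻¹ x i j k) x := by
  have hs := HasPD.norm_inv hx
  have hc := fun i => HasPD.coord (x := x) i
  have hk := fun i j => HasPD.const (x := x) (kron i j)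
  have h := ((((((HasPD.const (-1)).mul (hc k)).mul (hs.pow 2)).const_mul A).mul
    (hk i j)).add
    ((((((((hk 0 k).mul (hc i)).mul (hc j)).add (((hc 0).mul (hk i k)).mul (hc j))).add
      (((hc 0).mul (hc i)).mul (hk j k))).mul (hs.pow 3)).sub
      (((((((hc 0).mul (hc i)).mul (hc j)).mul (hc k)).const_mul 4).mul (hs.pow 5)))).sub
      ((((hk 0 k).mul (hs.pow 1)).sub ((((hc 0).mul (hc k)).const_mul 2).mul
        (hs.pow 3))).const_mul ((1 / 2) * kron i j))))
  refine (h.congr_deriv fun l => ?_).congr_of_eventuallyEq (.of_forall fun y => ?_)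
  · simp only [modelHess, radialHess, sigmaHess]
    push_cast
    ring
  · simp only [modelD, radialD, sigmaD]
    ring

theorem modelH_neg (A s : ℝ) (x : E3) (i j : Fin 3) :
    modelH A s (-x) i j = -modelH (-A) s x i j := by
  simp only [modelH, sigmaH, PiLp.neg_apply]; ring

theorem modelD_neg (A s : ℝ) (x : E3) (i j k : Fin 3) :
    modelD A s (-x) i j k = modelD (-A) s x i j k := by
  simp only [modelD, radialD, sigmaD, PiLp.neg_apply]; ring

theorem modelHess_neg (A s : ℝ) (x : E3) (i j k l : Fin 3) :
    modelHess A s (-x) i j k l = -modelHess (-A) s x i j k l := by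
  simp only [modelHess, radialHess, sigmaHess, PiLp.neg_apply]; ring

theorem modelH_homogeneous (A s : ℝ) (x : E3) (i j : Fin 3) :
    modelH A s x i j = s ^ 1 * modelH A 1 (s • x) i j := by
  simp only [modelH, sigmaH, PiLp.smul_apply, smul_eq_mul]; ring

theorem modelD_homogeneous (A s : ℝ) (x : E3) (i j k : Fin 3) :
    modelD A s x i j k = s ^ 2 * modelD A 1 (s • x) i j k := by
  simp only [modelD, radialD, sigmaD, PiLp.smul_apply, smul_eq_mul]; ring

theorem modelHess_homogeneous (A s : ℝ) (x : E3) (i j k l : Fin 3) :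
    modelHess A s x i j k l = s ^ 3 * modelHess A 1 (s • x) i j k l := by
  simp only [modelHess, radialHess, sigmaHess, PiLp.smul_apply, smul_eq_mul]; ring

/-- The second variation of the scalar curvature in the direction of the leading perturbation. -/
def modelQuad (A : ℝ) (x : E3) : ℝ :=
  secondVariation (modelH A ‖x‖⁻¹ x) (modelD A ‖x‖⁻¹ x) (modelHess A ‖x‖⁻¹ x)

theorem modelQuad_neg (A : ℝ) (x : E3) : modelQuad A (-x) = modelQuad (-A) x := by
  rw [modelQuad, norm_neg, modelQuad, ← secondVariation_neg]
  congr 1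
  · funext i j; rw [modelH_neg, neg_neg]
  · funext i j k; rw [modelD_neg]
  · funext i j k l; rw [modelHess_neg, neg_neg]

theorem modelQuad_sub_modelQuad_neg (A : ℝ) {x : E3} (hx : x ≠ 0) :
    modelQuad A x - modelQuad A (-x) = 3 * A * x 0 * ‖x‖⁻¹ ^ 5 := by
  rw [modelQuad_neg]
  have hu : ‖x‖⁻¹ ^ 2 * (x 0 ^ 2 + x 1 ^ 2 + x 2 ^ 2) = 1 := by
    have h := EuclideanSpace.real_norm_sq_eq x
    rw [Fin.sum_univ_three] at h
    rw [← h, ← mul_pow, inv_mul_cancel₀ (norm_ne_zero_iff.2 hx), one_pow]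
  generalize hs : ‖x‖⁻¹ = s at hu
  have h1 := secForm_conformal (A * s) (fun k l => A * radialHess s x k l) (sigmaH s x)
    (sigmaHess s x) (fun k l => by simp only [radialHess, kron_comm k l]; ring)
    (fun i j => by simp only [sigmaH, kron_comm i j]; ring)
    (fun i j k l => by simp only [sigmaHess, kron_comm i j]; ring)
    (fun i j k l => by simp only [sigmaHess, kron_comm k l]; ring)
  have h2 := quadForm_conformal (fun k => A * radialD s x k) (sigmaD s x)
    (fun i j k => by simp only [sigmaD, kron_comm i j]; ring)
  have h3 : linForm (sigmaHess s x) = 0 := by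
    simp only [linForm, sigmaHess, Fin.sum_univ_three, kron]
    simp only [Fin.isValue, Fin.reduceEq, if_true, if_false]
    ring
  have h4 : ∑ j, A * radialHess s x j j = 0 := by
    simp only [radialHess, Fin.sum_univ_three, kron]
    simp only [if_true]
    linear_combination 3 * A * s ^ 3 * hu
  have h5 : ∑ i, ∑ j, sigmaH s x i j * (A * radialHess s x i j) = 2 * A * x 0 * s ^ 5 := by
    simp only [radialHess, sigmaH, Fin.sum_univ_three, kron]
    simp only [Fin.isValue, Fin.reduceEq, if_true, if_false]
    linear_combination A * x 0 * s ^ 5 *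
      (3 * (s ^ 2 * (x 0 ^ 2 + x 1 ^ 2 + x 2 ^ 2)) + 1 / 2) * hu
  have h6 : ∑ j, A * radialD s x j * ∑ i, sigmaD s x i i j = -(1 / 2) * A * x 0 * s ^ 5 := by
    simp only [radialD, sigmaD, Fin.sum_univ_three, kron]
    simp only [Fin.isValue, Fin.reduceEq, if_true, if_false]
    linear_combination A * x 0 * s ^ 5 *
      (4 * (s ^ 2 * (x 0 ^ 2 + x 1 ^ 2 + x 2 ^ 2)) - 2) * hu
  rw [h3, h4, h5] at h1
  rw [h6] at h2
  simp only [← neg_mul] at h1 h2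
  rw [modelQuad, modelQuad, hs]
  exact (add_sub_add_comm _ _ _ _).trans ((congrArg₂ (· + ·) h1 h2).trans (by ring))

/-- `f₀ = O(r^{-n})` and `f = f₀ + o(r^{-n})` at infinity. -/
def Approx (n : ℕ) (f f₀ : E3 → ℝ) : Prop :=
  f₀ =O[cobounded E3] (fun x => ‖x‖⁻¹ ^ n) ∧
    (fun x => f x - f₀ x) =o[cobounded E3] (fun x => ‖x‖⁻¹ ^ n)

theorem tendsto_norm_inv_cobounded : Tendsto (fun x : E3 => ‖x‖⁻¹) (cobounded E3) (𝓝 0) :=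
  tendsto_inv_atTop_zero.comp tendsto_norm_cobounded_atTop

theorem eventually_norm_gt (ρ : ℝ) : ∀ᶠ x : E3 in cobounded E3, ρ < ‖x‖ :=
  tendsto_norm_cobounded_atTop.eventually_gt_atTop ρ

namespace Approx

variable {m n : ℕ} {f f₀ g g₀ : E3 → ℝ}

theorem isBigO (hf : Approx n f f₀) : f =O[cobounded E3] (fun x => ‖x‖⁻¹ ^ n) := by
  simpa using hf.1.add hf.2.isBigO

theorem congr' (hf : Approx n f f₀) (hfg : g =ᶠ[cobounded E3] f) (h₀ : ∀ x, g₀ x = f₀ x) :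
    Approx n g g₀ := by
  obtain rfl : g₀ = f₀ := funext h₀
  exact ⟨hf.1, hf.2.congr' (by filter_upwards [hfg] with x hx; rw [hx]) EventuallyEq.rfl⟩

theorem add (hf : Approx n f f₀) (hg : Approx n g g₀) :
    Approx n (fun x => f x + g x) (fun x => f₀ x + g₀ x) :=
  ⟨hf.1.add hg.1, (hf.2.add hg.2).congr_left fun x => by ring⟩

theorem const_mul (c : ℝ) (hf : Approx n f f₀) :
    Approx n (fun x => c * f x) (fun x => c * f₀ x) :=
  ⟨hf.1.const_mul_left c, (hf.2.const_mul_left c).congr_left fun x => by ring⟩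

theorem neg (hf : Approx n f f₀) : Approx n (fun x => -f x) (fun x => -f₀ x) := by
  simpa using hf.const_mul (-1)

theorem sub (hf : Approx n f f₀) (hg : Approx n g g₀) :
    Approx n (fun x => f x - g x) (fun x => f₀ x - g₀ x) := by
  simpa [sub_eq_add_neg] using hf.add hg.neg

theorem mul (hf : Approx m f f₀) (hg : Approx n g g₀) :
    Approx (m + n) (fun x => f x * g x) (fun x => f₀ x * g₀ x) := by
  have h1 := hf.isBigO.mul_isLittleO hg.2
  have h2 := hf.2.mul_isBigO hg.1
  refine ⟨(hf.1.mul hg.1).congr_right fun x => (pow_add _ _ _).symm, ?_⟩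
  exact ((h1.add h2).congr_right fun x => (pow_add _ _ _).symm).congr_left fun x => by ring

theorem sum {ι : Type*} {s : Finset ι} {F F₀ : ι → E3 → ℝ} (h : ∀ i ∈ s, Approx n (F i) (F₀ i)) :
    Approx n (fun x => ∑ i ∈ s, F i x) (fun x => ∑ i ∈ s, F₀ i x) :=
  ⟨IsBigO.fun_sum fun i hi => (h i hi).1, by
    simpa only [Finset.sum_sub_distrib] using IsLittleO.fun_sum fun i hi => (h i hi).2⟩

theorem const (c : ℝ) : Approx 0 (fun _ => c) (fun _ => c) := by
  refine ⟨?_, by simp⟩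
  simpa using isBigO_const_const c (one_ne_zero (α := ℝ)) _

theorem of_tendsto {c : ℝ} (h : Tendsto f (cobounded E3) (𝓝 c)) : Approx 0 f (fun _ => c) := by
  refine ⟨(const c).1, ?_⟩
  simpa [isLittleO_one_iff] using h.sub_const c

end Approx

theorem approx_chr {D D₀ : E3 → Fin 3 → Fin 3 → Fin 3 → ℝ}
    (hD : ∀ i j k, Approx 2 (fun x => D x i j k) (fun x => D₀ x i j k)) (i j l : Fin 3) :
    Approx 2 (fun x => chr (D x) i j l) (fun x => chr (D₀ x) i j l) :=
  ((hD _ _ _).add (hD _ _ _)).sub (hD _ _ _)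

theorem approx_dchr {H H₀ : E3 → Fin 3 → Fin 3 → Fin 3 → Fin 3 → ℝ}
    (hH : ∀ i j k l, Approx 3 (fun x => H x i j k l) (fun x => H₀ x i j k l)) (i j l m : Fin 3) :
    Approx 3 (fun x => dchr (H x) i j l m) (fun x => dchr (H₀ x) i j l m) :=
  ((hH _ _ _ _).add (hH _ _ _ _)).sub (hH _ _ _ _)

theorem approx_gam {G : E3 → Fin 3 → Fin 3 → ℝ} {D D₀ : E3 → Fin 3 → Fin 3 → Fin 3 → ℝ}
    (hG : ∀ i j, Approx 0 (fun x => G x i j) (fun _ => kron i j))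
    (hD : ∀ i j k, Approx 2 (fun x => D x i j k) (fun x => D₀ x i j k)) (k i j : Fin 3) :
    Approx 2 (fun x => gam (G x) (D x) k i j) (fun x => gam kron (D₀ x) k i j) := by
  refine .const_mul _ (.sum fun l _ => ?_)
  simpa using (hG k l).mul (approx_chr hD i j l)

theorem approx_quadForm {G : E3 → Fin 3 → Fin 3 → ℝ}
    {dG dG₀ D D₀ : E3 → Fin 3 → Fin 3 → Fin 3 → ℝ}
    (hG : ∀ i j, Approx 0 (fun x => G x i j) (fun _ => kron i j))
    (hdG : ∀ i j k, Approx 2 (fun x => dG x i j k) (fun x => dG₀ x i j k))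
    (hD : ∀ i j k, Approx 2 (fun x => D x i j k) (fun x => D₀ x i j k)) :
    Approx 4 (fun x => quadForm (G x) (dG x) (D x)) (fun x => quadForm kron (dG₀ x) (D₀ x)) := by
  have hc := approx_chr hD
  have hg := approx_gam hG hD
  refine .sum fun i _ => .sum fun k _ => ?_
  have h : Approx 4
      (fun x => (∑ j, ((1 / 2) * ∑ l, dG x j l j * chr (D x) i k l
          - (1 / 2) * ∑ l, dG x j l i * chr (D x) j k l))
        + ∑ j, ∑ m, (gam (G x) (D x) m i k * gam (G x) (D x) j j m
          - gam (G x) (D x) m j k * gam (G x) (D x) j i m))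
      (fun x => (∑ j, ((1 / 2) * ∑ l, dG₀ x j l j * chr (D₀ x) i k l
          - (1 / 2) * ∑ l, dG₀ x j l i * chr (D₀ x) j k l))
        + ∑ j, ∑ m, (gam kron (D₀ x) m i k * gam kron (D₀ x) j j m
          - gam kron (D₀ x) m j k * gam kron (D₀ x) j i m)) :=
    (Approx.sum fun j _ => (Approx.const_mul _ (.sum fun l _ => (hdG _ _ _).mul (hc _ _ _))).sub
      (Approx.const_mul _ (.sum fun l _ => (hdG _ _ _).mul (hc _ _ _)))).add
    (.sum fun j _ => .sum fun m _ => ((hg _ _ _).mul (hg _ _ _)).sub ((hg _ _ _).mul (hg _ _ _)))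
  simpa using (hG i k).mul h

theorem approx_secForm {P P₀ H H₀ : E3 → Fin 3 → Fin 3 → Fin 3 → Fin 3 → ℝ}
    (hP : ∀ i j k l, Approx 1 (fun x => P x i j k l) (fun x => P₀ x i j k l))
    (hH : ∀ i j k l, Approx 3 (fun x => H x i j k l) (fun x => H₀ x i j k l)) :
    Approx 4 (fun x => secForm (P x) (H x)) (fun x => secForm (P₀ x) (H₀ x)) := by
  refine .sum fun i _ => .sum fun k _ => .sum fun j _ => .sum fun l _ => ?_
  simpa using (hP i k j l).mul
    (Approx.const_mul (1 / 2) ((approx_dchr hH i k l j).sub (approx_dchr hH j k l i)))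

theorem isBigO_of_homogeneous {P : ℝ → E3 → ℝ} {n : ℕ} (hP : ∀ s x, P s x = s ^ n * P 1 (s • x))
    (hc : Continuous (P 1)) :
    (fun x => P ‖x‖⁻¹ x) =O[cobounded E3] (fun x => ‖x‖⁻¹ ^ n) := by
  obtain ⟨C, hC⟩ := (isCompact_closedBall (0 : E3) 1).exists_bound_of_continuousOn hc.continuousOn
  refine IsBigO.of_bound C (.of_forall fun x => ?_)
  rw [hP, norm_mul, mul_comm]
  gcongr
  refine hC _ ?_
  rw [mem_closedBall_zero_iff, norm_smul, norm_inv, norm_norm]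
  exact inv_mul_le_one

theorem isLittleO_of_rpow_bound {f : E3 → ℝ} {C t ρ₀ : ℝ} {n : ℕ} (ht : t < -n)
    (hf : ∀ x : E3, ρ₀ ≤ ‖x‖ → |f x| ≤ C * ‖x‖ ^ t) :
    f =o[cobounded E3] (fun x => ‖x‖⁻¹ ^ n) := by
  have h1 : f =O[cobounded E3] (fun x => ‖x‖ ^ t) := by
    refine IsBigO.of_bound C ?_
    filter_upwards [eventually_norm_gt ρ₀] with x hx
    rw [Real.norm_eq_abs, Real.norm_of_nonneg (Real.rpow_nonneg (norm_nonneg x) t)]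
    exact hf x hx.le
  refine h1.trans_isLittleO ?_
  have h2 : (fun r : ℝ => r ^ t) =o[atTop] (fun r : ℝ => r ^ (-(n : ℝ))) := by
    rw [isLittleO_iff_tendsto' (by
      filter_upwards [eventually_gt_atTop 0] with r hr h
      exact absurd h (Real.rpow_pos_of_pos hr _).ne')]
    refine (tendsto_rpow_neg_atTop (y := -n - t) (by linarith)).congr' ?_
    filter_upwards [eventually_gt_atTop 0] with r hr
    rw [← Real.rpow_sub hr]
    ring_nf
  have h3 := h2.comp_tendsto (tendsto_norm_cobounded_atTop (E := E3))
  refine h3.congr_right fun x => ?_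
  simp [Function.comp, Real.rpow_neg (norm_nonneg x)]

theorem continuous_modelH (A : ℝ) (i j : Fin 3) : Continuous fun x => modelH A 1 x i j := by
  unfold modelH sigmaH
  fun_prop

theorem continuous_modelD (A : ℝ) (i j k : Fin 3) : Continuous fun x => modelD A 1 x i j k := by
  unfold modelD radialD sigmaD
  fun_prop

theorem continuous_modelHess (A : ℝ) (i j k l : Fin 3) :
    Continuous fun x => modelHess A 1 x i j k l := by
  unfold modelHess radialHess sigmaHess
  fun_prop

section Perturbation

variable {f : E3 → ℝ} {A c q ρ₀ : ℝ} {i j : Fin 3}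

theorem hasPD_sub_model (hρ₀ : 0 ≤ ρ₀) (hf : ContDiffOn ℝ 2 f {x | ρ₀ < ‖x‖}) {x : E3}
    (hx : ρ₀ < ‖x‖) :
    HasPD (fun x => f x - (c + modelH A ‖x‖⁻¹ x i j))
      (fun k => pd f k x - modelD A ‖x‖⁻¹ x i j k) x := by
  have hx0 : x ≠ 0 := norm_pos_iff.1 (hρ₀.trans_lt hx)
  have hd : DifferentiableAt ℝ f x :=
    (hf.differentiableOn (by simp)).differentiableAt ((isOpen_exterior ρ₀).mem_nhds hx)
  exact ((HasPD.of_differentiableAt hd).sub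
    ((HasPD.const c).add (hasPD_modelH A i j hx0))).congr_deriv fun k => by ring

theorem hasPD_pd_sub_model (hρ₀ : 0 ≤ ρ₀) (hf : ContDiffOn ℝ 2 f {x | ρ₀ < ‖x‖}) {x : E3}
    (hx : ρ₀ < ‖x‖) (k : Fin 3) :
    HasPD (pd (fun x => f x - (c + modelH A ‖x‖⁻¹ x i j)) k)
      (fun l => pd (pd f k) l x - modelHess A ‖x‖⁻¹ x i j k l) x := by
  have hU := (isOpen_exterior ρ₀).mem_nhds hx
  have hx0 : x ≠ 0 := norm_pos_iff.1 (hρ₀.trans_lt hx)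
  have hd : DifferentiableAt ℝ (pd f k) x :=
    ((contDiffOn_pd (isOpen_exterior ρ₀) hf k).differentiableOn (by simp)).differentiableAt hU
  refine ((HasPD.of_differentiableAt hd).sub (hasPD_modelD A i j k hx0)).congr_of_eventuallyEq ?_
  filter_upwards [hU] with y hy
  exact (hasPD_sub_model hρ₀ hf hy).2 k

theorem approx_modelH (hq : 0 < q)
    (hO : IsO2 (fun x => f x - (c + modelH A ‖x‖⁻¹ x i j)) (1 + q) ρ₀) :
    Approx 1 (fun x => f x - c) (fun x => modelH A ‖x‖⁻¹ x i j) := by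
  obtain ⟨C, hC⟩ := hO
  refine ⟨isBigO_of_homogeneous (P := fun s x => modelH A s x i j)
    (fun s x => modelH_homogeneous A s x i j) (continuous_modelH A i j), ?_⟩
  refine (isLittleO_of_rpow_bound (t := -(1 + q)) (by push_cast; linarith)
    fun x hx => (hC x hx).1).congr_left fun x => by ring

theorem approx_modelD (hq : 0 < q)
    (hO : IsO2 (fun x => f x - (c + modelH A ‖x‖⁻¹ x i j)) (1 + q) ρ₀)
    (hρ₀ : 0 ≤ ρ₀) (hf : ContDiffOn ℝ 2 f {x | ρ₀ < ‖x‖}) (k : Fin 3) :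
    Approx 2 (pd f k) (fun x => modelD A ‖x‖⁻¹ x i j k) := by
  obtain ⟨C, hC⟩ := hO
  refine ⟨isBigO_of_homogeneous (P := fun s x => modelD A s x i j k)
    (fun s x => modelD_homogeneous A s x i j k) (continuous_modelD A i j k), ?_⟩
  refine (isLittleO_of_rpow_bound (t := -(1 + q) - 1) (by push_cast; linarith)
    fun x hx => (hC x hx).2.1 k).congr' ?_ .rfl
  filter_upwards [eventually_norm_gt ρ₀] with x hx
  exact (hasPD_sub_model hρ₀ hf hx).2 k

theorem approx_modelHess (hq : 0 < q)
    (hO : IsO2 (fun x => f x - (c + modelH A ‖x‖⁻¹ x i j)) (1 + q) ρ₀)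
    (hρ₀ : 0 ≤ ρ₀) (hf : ContDiffOn ℝ 2 f {x | ρ₀ < ‖x‖}) (k l : Fin 3) :
    Approx 3 (pd (pd f k) l) (fun x => modelHess A ‖x‖⁻¹ x i j k l) := by
  obtain ⟨C, hC⟩ := hO
  refine ⟨isBigO_of_homogeneous (P := fun s x => modelHess A s x i j k l)
    (fun s x => modelHess_homogeneous A s x i j k l) (continuous_modelHess A i j k l), ?_⟩
  refine (isLittleO_of_rpow_bound (t := -(1 + q) - 2) (by push_cast; linarith)
    fun x hx => (hC x hx).2.2 k l).congr' ?_ .rfl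
  filter_upwards [eventually_norm_gt ρ₀] with x hx
  exact (hasPD_pd_sub_model hρ₀ hf hx k).2 l

end Perturbation

theorem one_apply_eq_kron (i j : Fin 3) : (1 : Matrix (Fin 3) (Fin 3) ℝ) i j = kron i j := by
  simp [Matrix.one_apply, kron]

section Inverse

variable {g : E3 → Matrix (Fin 3) (Fin 3) ℝ}

theorem differentiableAt_inv_apply {x : E3}
    (hg : ∀ i j, DifferentiableAt ℝ (fun y => g y i j) x) (hdet : (g x).det ≠ 0) (i j : Fin 3) :
    DifferentiableAt ℝ (fun y => (g y)⁻¹ i j) x := by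
  have hd : DifferentiableAt ℝ (fun y => (g y).det) x := by
    simp only [Matrix.det_fin_three]
    fun_prop
  have ha : DifferentiableAt ℝ (fun y => (g y).adjugate i j) x := by
    simp only [Matrix.adjugate_fin_three]
    fin_cases i <;> fin_cases j <;> simp <;> fun_prop
  simp only [Matrix.inv_def, Ring.inverse_eq_inv', Matrix.smul_apply, smul_eq_mul]
  exact (hd.inv hdet).mul ha

theorem hasPD_inv_apply {x : E3}
    (hg : ∀ i j, DifferentiableAt ℝ (fun y => g y i j) x) (hdet : ∀ᶠ y in 𝓝 x, (g y).det ≠ 0)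
    (a b : Fin 3) :
    HasPD (fun y => (g y)⁻¹ a b)
      (fun m => -∑ l, (∑ k, (g x)⁻¹ a k * pd (fun y => g y k l) m x) * (g x)⁻¹ l b) x := by
  have hG := differentiableAt_inv_apply hg hdet.self_of_nhds
  refine ⟨hG a b, fun m => ?_⟩
  have hmul : ∀ c, ∑ k, ((g x)⁻¹ a k * pd (fun y => g y k c) m x
      + g x k c * pd (fun y => (g y)⁻¹ a k) m x) = 0 := fun c => by
    have h := HasPD.sum (s := Finset.univ) fun k _ =>
      (HasPD.of_differentiableAt (hG a k)).mul (HasPD.of_differentiableAt (hg k c))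
    have h' : HasPD (fun y => ∑ k, (g y)⁻¹ a k * g y k c) (fun _ => 0) x := by
      refine (HasPD.const (kron a c)).congr_of_eventuallyEq ?_
      filter_upwards [hdet] with y hy
      rw [← Matrix.mul_apply, Matrix.nonsing_inv_mul _ hy.isUnit, one_apply_eq_kron]
    exact (h.2 m).symm.trans (h'.2 m)
  set dG : Matrix (Fin 3) (Fin 3) ℝ := .of fun i j => pd (fun y => (g y)⁻¹ i j) m x
  set dg : Matrix (Fin 3) (Fin 3) ℝ := .of fun i j => pd (fun y => g y i j) m x
  have h1 : ∀ c, ((g x)⁻¹ * dg) a c = -(dG * g x) a c := fun c => by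
    rw [eq_neg_iff_add_eq_zero, Matrix.mul_apply, Matrix.mul_apply, ← Finset.sum_add_distrib,
      ← hmul c]
    exact Finset.sum_congr rfl fun k _ => by simp only [dg, dG, Matrix.of_apply]; ring
  have h2 : dG a b = -(((g x)⁻¹ * dg) * (g x)⁻¹) a b := by
    rw [Matrix.mul_apply]
    simp only [h1, neg_mul, Finset.sum_neg_distrib, neg_neg]
    rw [← Matrix.mul_apply, Matrix.mul_assoc, Matrix.mul_nonsing_inv _ hdet.self_of_nhds.isUnit,
      Matrix.mul_one]
  simpa only [Matrix.mul_apply, dG, dg, Matrix.of_apply] using h2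

end Inverse

section InverseAsymptotics

variable {g : E3 → Matrix (Fin 3) (Fin 3) ℝ} {h₀ : E3 → Fin 3 → Fin 3 → ℝ}

theorem approx_inv (hg : ∀ i j, Approx 1 (fun x => g x i j - kron i j) (fun x => h₀ x i j))
    (i j : Fin 3) : Approx 0 (fun x => (g x)⁻¹ i j) (fun _ => kron i j) := by
  have hlim : Tendsto g (cobounded E3) (𝓝 1) := by
    refine tendsto_pi_nhds.2 fun i => tendsto_pi_nhds.2 fun j => ?_
    have h := (hg i j).isBigO.trans_tendsto (by simpa using tendsto_norm_inv_cobounded)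
    rw [one_apply_eq_kron]
    simpa using h.add_const (kron i j)
  have hdet : Tendsto (fun x => (g x).det⁻¹) (cobounded E3) (𝓝 1) := by
    have h := (Continuous.matrix_det continuous_id).tendsto (1 : Matrix (Fin 3) (Fin 3) ℝ)
    simpa using (h.comp hlim).inv₀ (by simp)
  have hadj : Tendsto (fun x => (g x).adjugate i j) (cobounded E3) (𝓝 (kron i j)) := by
    have h := ((Continuous.matrix_adjugate continuous_id).matrix_elem i j).tendsto
      (1 : Matrix (Fin 3) (Fin 3) ℝ)
    simpa [one_apply_eq_kron, Function.comp_def] using h.comp hlim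
  refine Approx.of_tendsto ?_
  simpa [Matrix.inv_def] using hdet.mul hadj

theorem approx_inv_sub (hg : ∀ i j, Approx 1 (fun x => g x i j - kron i j) (fun x => h₀ x i j))
    (hdet : ∀ᶠ x in cobounded E3, (g x).det ≠ 0) (i k : Fin 3) :
    Approx 1 (fun x => (g x)⁻¹ i k - kron i k) (fun x => -h₀ x i k) := by
  have h : Approx 1 (fun x => -∑ l, (g x)⁻¹ i l * (g x l k - kron l k))
      (fun x => -∑ l, kron i l * h₀ x l k) :=
    (Approx.sum fun l _ => by simpa using (approx_inv hg i l).mul (hg l k)).neg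
  refine h.congr' ?_ fun x => by simp [kron]
  filter_upwards [hdet] with x hx
  simp only [mul_sub, Finset.sum_sub_distrib]
  rw [← Matrix.mul_apply, Matrix.nonsing_inv_mul _ hx.isUnit, one_apply_eq_kron]
  simp [kron]

theorem approx_inv_mul_inv_sub
    (hg : ∀ i j, Approx 1 (fun x => g x i j - kron i j) (fun x => h₀ x i j))
    (hdet : ∀ᶠ x in cobounded E3, (g x).det ≠ 0) (i k j l : Fin 3) :
    Approx 1 (fun x => (g x)⁻¹ i k * (g x)⁻¹ j l - kron i k * kron j l)
      (fun x => -h₀ x i k * kron j l + kron i k * -h₀ x j l) := by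
  have h := ((approx_inv_sub hg hdet i k).mul (approx_inv hg j l)).add
    ((approx_inv_sub hg hdet j l).const_mul (kron i k))
  exact h.congr' (.of_forall fun x => by ring) fun x => rfl

theorem approx_inv_deriv {D D₀ : E3 → Fin 3 → Fin 3 → Fin 3 → ℝ}
    (hg : ∀ i j, Approx 1 (fun x => g x i j - kron i j) (fun x => h₀ x i j))
    (hD : ∀ i j k, Approx 2 (fun x => D x i j k) (fun x => D₀ x i j k)) (a b m : Fin 3) :
    Approx 2 (fun x => -∑ l, (∑ k, (g x)⁻¹ a k * D x k l m) * (g x)⁻¹ l b)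
      (fun x => -D₀ x a b m) := by
  have hG := approx_inv hg
  have h : Approx 2 (fun x => -∑ l, (∑ k, (g x)⁻¹ a k * D x k l m) * (g x)⁻¹ l b)
      (fun x => -∑ l, (∑ k, kron a k * D₀ x k l m) * kron l b) :=
    (Approx.sum fun l _ => Approx.mul (n := 0) (.sum fun k _ => by
      simpa using (hG a k).mul (hD k l m)) (hG l b)).neg
  exact h.congr' .rfl fun x => by simp [kron]

end InverseAsymptotics

/-- First derivatives of the entries of `g`. -/
def metricD (g : E3 → Matrix (Fin 3) (Fin 3) ℝ) (x : E3) (i j k : Fin 3) : ℝ :=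
  pd (fun y => g y i j) k x

/-- Second derivatives of the entries of `g`. -/
def metricHess (g : E3 → Matrix (Fin 3) (Fin 3) ℝ) (x : E3) (i j k l : Fin 3) : ℝ :=
  pd (pd (fun y => g y i j) k) l x

/-- First derivatives of the entries of the inverse of `g`. -/
def inverseD (g : E3 → Matrix (Fin 3) (Fin 3) ℝ) (x : E3) (i j k : Fin 3) : ℝ :=
  -∑ l, (∑ m, (g x)⁻¹ i m * metricD g x m l k) * (g x)⁻¹ l j

section Curvature

variable {g : E3 → Matrix (Fin 3) (Fin 3) ℝ} {x : E3}

theorem hasPD_Gamma (hg : ∀ i j, DifferentiableAt ℝ (fun y => g y i j) x)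
    (hg' : ∀ i j k, DifferentiableAt ℝ (pd (fun y => g y i j) k) x)
    (hdet : ∀ᶠ y in 𝓝 x, (g y).det ≠ 0) (k i j : Fin 3) :
    HasPD (fun y => Gamma g k i j y)
      (fun m => (1 / 2) * ∑ l, ((g x)⁻¹ k l * dchr (metricHess g x) i j l m
        + chr (metricD g x) i j l * inverseD g x k l m)) x := by
  have hD := fun i j k => HasPD.of_differentiableAt (hg' i j k)
  exact (HasPD.sum fun l _ => (hasPD_inv_apply hg hdet k l).mul
    (((hD i l j).add (hD j l i)).sub (hD i j l))).const_mul (1 / 2)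

theorem scalarCurvature_eq (hg : ∀ i j, DifferentiableAt ℝ (fun y => g y i j) x)
    (hg' : ∀ i j k, DifferentiableAt ℝ (pd (fun y => g y i j) k) x)
    (hdet : ∀ᶠ y in 𝓝 x, (g y).det ≠ 0) :
    scalarCurvature g x = secForm (fun i k j l => (g x)⁻¹ i k * (g x)⁻¹ j l) (metricHess g x)
      + quadForm (fun i j => (g x)⁻¹ i j) (inverseD g x) (metricD g x) := by
  have hΓ : ∀ k i j, Gamma g k i j x = gam (fun i j => (g x)⁻¹ i j) (metricD g x) k i j :=
    fun k i j => rfl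
  simp only [scalarCurvature, secForm, quadForm, (hasPD_Gamma hg hg' hdet _ _ _).2, hΓ]
  rw [← Finset.sum_add_distrib]
  refine Finset.sum_congr rfl fun i _ => ?_
  rw [← Finset.sum_add_distrib]
  refine Finset.sum_congr rfl fun k _ => ?_
  generalize ∑ j, ∑ m, (gam _ _ m i k * gam _ _ j j m - gam _ _ m j k * gam _ _ j i m) = Q
  rw [mul_add, mul_add, ← add_assoc]
  congr 1
  rw [Finset.mul_sum, Finset.mul_sum, ← Finset.sum_add_distrib]
  refine Finset.sum_congr rfl fun j _ => ?_
  simp only [Fin.sum_univ_three]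
  ring

theorem metricHess_comm (hsymm : ∀ᶠ y in 𝓝 x, (g y).IsSymm) (i j k l : Fin 3) :
    metricHess g x i j k l = metricHess g x j i k l := by
  have h : (fun y => g y i j) =ᶠ[𝓝 x] fun y => g y j i := by
    filter_upwards [hsymm] with y hy
    exact hy.apply j i
  have h' : pd (fun y => g y i j) k =ᶠ[𝓝 x] pd (fun y => g y j i) k := by
    filter_upwards [h.eventuallyEq_nhds] with y hy
    rw [pd, pd, hy.fderiv_eq]
  rw [metricHess, metricHess, pd, pd, h'.fderiv_eq]

end Curvature

section ScalarFlat

variable {g : E3 → Matrix (Fin 3) (Fin 3) ℝ} {A q ρ₀ : ℝ}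

theorem differentiableAt_of_exterior {f : E3 → ℝ} (hf : ContDiffOn ℝ 1 f {x | ρ₀ < ‖x‖}) {x : E3}
    (hx : ρ₀ < ‖x‖) : DifferentiableAt ℝ f x :=
  (hf.differentiableOn one_ne_zero).differentiableAt ((isOpen_exterior ρ₀).mem_nhds hx)

theorem linForm_metricHess_eq
    (hg : ∀ i j, ContDiffOn ℝ 2 (fun x => g x i j) {x | ρ₀ < ‖x‖})
    (hdet : ∀ x, ρ₀ < ‖x‖ → (g x).det ≠ 0) (hsymm : ∀ x, ρ₀ < ‖x‖ → (g x).IsSymm)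
    (hflat : ∀ x, ρ₀ < ‖x‖ → scalarCurvature g x = 0) {x : E3} (hx : ρ₀ < ‖x‖) :
    -linForm (metricHess g x) =
      secForm (fun i k j l => (g x)⁻¹ i k * (g x)⁻¹ j l - kron i k * kron j l) (metricHess g x)
        + quadForm (fun i j => (g x)⁻¹ i j) (inverseD g x) (metricD g x) := by
  have hU := (isOpen_exterior ρ₀).mem_nhds hx
  have h := scalarCurvature_eq
    (fun i j => differentiableAt_of_exterior ((hg i j).of_le one_le_two) hx)
    (fun i j k => differentiableAt_of_exterior
      (contDiffOn_pd (isOpen_exterior ρ₀) (hg i j) k) hx) (eventually_of_mem hU hdet)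
  rw [hflat x hx] at h
  have h' := secForm_kron (metricHess_comm (eventually_of_mem hU hsymm))
  have h'' : secForm (fun i k j l => (g x)⁻¹ i k * (g x)⁻¹ j l - kron i k * kron j l)
      (metricHess g x) = secForm (fun i k j l => (g x)⁻¹ i k * (g x)⁻¹ j l) (metricHess g x)
        - secForm (fun i k j l => kron i k * kron j l) (metricHess g x) := by
    simp only [secForm, sub_mul, Finset.sum_sub_distrib]
  linarith

theorem approx_linForm_metricHess (hρ₀ : 0 ≤ ρ₀) (hq : 0 < q)
    (hg : ∀ i j, ContDiffOn ℝ 2 (fun x => g x i j) {x | ρ₀ < ‖x‖})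
    (hdet : ∀ x, ρ₀ < ‖x‖ → (g x).det ≠ 0) (hsymm : ∀ x, ρ₀ < ‖x‖ → (g x).IsSymm)
    (hO : ∀ i j, IsO2 (fun x => g x i j - (kron i j + modelH A ‖x‖⁻¹ x i j)) (1 + q) ρ₀)
    (hflat : ∀ x, ρ₀ < ‖x‖ → scalarCurvature g x = 0) :
    Approx 4 (fun x => -linForm (metricHess g x)) (modelQuad A) := by
  have hdet' : ∀ᶠ x in cobounded E3, (g x).det ≠ 0 := (eventually_norm_gt ρ₀).mono hdet
  have hH := fun i j => approx_modelH hq (hO i j)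
  have hD : ∀ i j k, Approx 2 (fun x => metricD g x i j k) (fun x => modelD A ‖x‖⁻¹ x i j k) :=
    fun i j k => approx_modelD hq (hO i j) hρ₀ (hg i j) k
  have hHess : ∀ i j k l, Approx 3 (fun x => metricHess g x i j k l)
      (fun x => modelHess A ‖x‖⁻¹ x i j k l) :=
    fun i j k l => approx_modelHess hq (hO i j) hρ₀ (hg i j) k l
  refine ((approx_secForm (approx_inv_mul_inv_sub hH hdet') hHess).add
    (approx_quadForm (approx_inv hH) (approx_inv_deriv hH hD) hD)).congr' ?_ fun x => rfl
  filter_upwards [eventually_norm_gt ρ₀] with x hx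
  exact linForm_metricHess_eq hg hdet hsymm hflat hx

theorem isLittleO_linForm_sub_neg {L : E3 → ℝ} (hL : Approx 4 (fun x => -L x) (modelQuad A)) :
    (fun x => L x - L (-x) + 3 * A * x 0 * ‖x‖⁻¹ ^ 5) =o[cobounded E3]
      (fun x => ‖x‖⁻¹ ^ 4) := by
  have h := hL.2.comp_tendsto (tendsto_neg_cobounded (E := E3))
  simp only [Function.comp_def, norm_neg] at h
  refine (h.sub hL.2).congr' ?_ .rfl
  filter_upwards [eventually_norm_gt 0] with x hx
  rw [← modelQuad_sub_modelQuad_neg A (norm_pos_iff.1 hx)]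
  ring

end ScalarFlat

/-- The vector field whose flux through spheres is the first component of the center of mass. -/
def fluxField (g : E3 → Matrix (Fin 3) (Fin 3) ℝ) (j : Fin 3) (x : E3) : ℝ :=
  x 0 * ∑ i, (pd (fun y => g y i j) i x - pd (fun y => g y i i) j x)
    - g x j 0 + kron j 0 * ∑ i, g x i i

theorem ctmIntegral_eq_flux (g : E3 → Matrix (Fin 3) (Fin 3) ℝ) {ρ : ℝ} (hρ : 0 < ρ) :
    ctmIntegral g 0 ρ = ρ ^ 2 * ∫ x, ∑ j, fluxField g j (ρ • x) * x j ∂unitSphereMeasure := by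
  rw [ctmIntegral, sphereIntegral_eq hρ]
  congr 2
  funext x
  have h : ∀ j, (ρ • x) j / ρ = x j := fun j => by
    rw [PiLp.smul_apply, smul_eq_mul, mul_div_cancel_left₀ _ hρ.ne']
  simp only [h, fluxField, Fin.sum_univ_three, kron, Fin.isValue, Fin.reduceEq, if_true, if_false]
  ring

section Flux

variable {g : E3 → Matrix (Fin 3) (Fin 3) ℝ} {ρ₀ : ℝ}

theorem contDiffOn_fluxField (hg : ∀ i j, ContDiffOn ℝ 2 (fun x => g x i j) {x | ρ₀ < ‖x‖})
    (j : Fin 3) : ContDiffOn ℝ 1 (fluxField g j) {x | ρ₀ < ‖x‖} := by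
  have h1 := fun i j => (hg i j).of_le one_le_two
  have h2 := fun i j k => contDiffOn_pd (isOpen_exterior ρ₀) (hg i j) k
  have h0 : ContDiffOn ℝ 1 (fun x : E3 => x 0) {x | ρ₀ < ‖x‖} := by fun_prop
  exact ((h0.mul (ContDiffOn.sum fun i _ => (h2 i j i).sub (h2 i i j))).sub (h1 j 0)).add
    (contDiffOn_const.mul (ContDiffOn.sum fun i _ => h1 i i))

theorem sum_pd_fluxField (hg : ∀ i j, ContDiffOn ℝ 2 (fun x => g x i j) {x | ρ₀ < ‖x‖})
    {x : E3} (hx : ρ₀ < ‖x‖) :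
    ∑ j, pd (fluxField g j) j x = x 0 * linForm (metricHess g x) := by
  have h1 := fun i j => HasPD.of_differentiableAt
    (differentiableAt_of_exterior ((hg i j).of_le one_le_two) hx)
  have h2 := fun i j k => HasPD.of_differentiableAt
    (differentiableAt_of_exterior (contDiffOn_pd (isOpen_exterior ρ₀) (hg i j) k) hx)
  have h := fun j => ((((HasPD.coord 0).mul (.sum (s := Finset.univ) fun i _ =>
    (h2 i j i).sub (h2 i i j))).sub (h1 j 0)).add
    ((HasPD.sum (s := Finset.univ) fun i _ => h1 i i).const_mul (kron j 0))).2 j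
  refine (Finset.sum_congr rfl fun j _ => h j).trans ?_
  simp only [linForm, metricHess, Fin.sum_univ_three, kron, Fin.isValue, Fin.reduceEq, if_true,
    if_false]
  ring

theorem continuousOn_linForm_metricHess
    (hg : ∀ i j, ContDiffOn ℝ 2 (fun x => g x i j) {x | ρ₀ < ‖x‖}) :
    ContinuousOn (fun x => linForm (metricHess g x)) {x | ρ₀ < ‖x‖} := by
  have h := fun i j k l => continuousOn_pd (isOpen_exterior ρ₀)
    (contDiffOn_pd (isOpen_exterior ρ₀) (hg i j) k) l
  exact continuousOn_finsetSum _ fun i _ => continuousOn_finsetSum _ fun j _ =>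
    (h i j i j).sub (h i i j j)

end Flux

theorem integrable_coord_mul {L : E3 → ℝ} {ρ₀ ρ : ℝ} (hL : ContinuousOn L {x | ρ₀ < ‖x‖})
    (hρ : ρ₀ < ρ) : Integrable (fun x : E3 => x 0 * L (ρ • x)) unitSphereMeasure := by
  refine integrable_unitSphereMeasure (ContinuousOn.mul (by fun_prop) ?_)
  refine hL.comp (by fun_prop) fun x hx => ?_
  rw [mem_sphere_zero_iff_norm] at hx
  rw [Set.mem_ofPred_eq, norm_smul, hx, mul_one]
  exact hρ.trans_le (le_abs_self ρ)

theorem integral_coord_mul_add {L : E3 → ℝ} {ρ₀ ρ : ℝ} (c : ℝ)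
    (hL : ContinuousOn L {x | ρ₀ < ‖x‖}) (hρ : ρ₀ < ρ) :
    2 * ∫ x, x 0 * L (ρ • x) ∂unitSphereMeasure + c * ∫ x, x 0 ^ 2 ∂unitSphereMeasure =
      ∫ x, x 0 * (L (ρ • x) - L (-(ρ • x)) + c * x 0) ∂unitSphereMeasure := by
  have hInt := integrable_coord_mul hL hρ
  have hInt' := (measurePreserving_unitSphereMeasure
    (LinearIsometryEquiv.neg ℝ)).integrable_comp_of_integrable hInt
  have heq := integral_comp_unitSphereMeasure (LinearIsometryEquiv.neg ℝ)
    (fun x : E3 => x 0 * L (ρ • x))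
  have hsq : Integrable (fun x : E3 => c * x 0 ^ 2) unitSphereMeasure :=
    integrable_unitSphereMeasure (by fun_prop)
  simp only [Function.comp_def] at hInt'
  rw [two_mul]
  nth_rewrite 2 [← heq]
  rw [← integral_const_mul, ← integral_add hInt hInt', ← integral_add (hInt.fun_add hInt') hsq]
  refine integral_congr_ae (.of_forall fun x => ?_)
  simp only [LinearIsometryEquiv.coe_neg, PiLp.neg_apply, smul_neg]
  ring

theorem tendsto_pow_mul_integral {L : E3 → ℝ} {A ρ₀ : ℝ} (hc : ContinuousOn L {x | ρ₀ < ‖x‖})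
    (hL : (fun x => L x - L (-x) + 3 * A * x 0 * ‖x‖⁻¹ ^ 5) =o[cobounded E3]
      (fun x => ‖x‖⁻¹ ^ 4)) :
    Tendsto (fun ρ : ℝ => ρ ^ 4 * ∫ x, x 0 * L (ρ • x) ∂unitSphereMeasure) atTop
      (𝓝 (-(3 / 2) * A * ∫ x, x 0 ^ 2 ∂unitSphereMeasure)) := by
  set m := ∫ x : E3, x 0 ^ 2 ∂unitSphereMeasure
  set N := unitSphereMeasure.real Set.univ
  have hN : 0 ≤ N := measureReal_nonneg
  refine Metric.tendsto_nhds.2 fun ε hε => ?_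
  have hδ : 0 < ε / (N + 1) := by positivity
  obtain ⟨R, -, hR⟩ := (hasBasis_cobounded_norm (E := E3)).eventually_iff.1 (hL.def hδ)
  filter_upwards [eventually_gt_atTop ρ₀, eventually_gt_atTop 0, eventually_ge_atTop R]
    with ρ hρ hρ' hρR
  have hbound : ‖∫ x, x 0 * (L (ρ • x) - L (-(ρ • x)) + 3 * A * ρ⁻¹ ^ 4 * x 0)
      ∂unitSphereMeasure‖ ≤ ε / (N + 1) * ρ⁻¹ ^ 4 * N := by
    refine norm_integral_le_of_norm_le_const ?_
    filter_upwards [ae_norm_eq_one] with x hx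
    have hn : ‖ρ • x‖ = ρ := by rw [norm_smul, hx, mul_one, Real.norm_of_nonneg hρ'.le]
    have h := hR (x := ρ • x) (by simpa [hn] using hρR)
    rw [hn, Real.norm_of_nonneg (by positivity : 0 ≤ ρ⁻¹ ^ 4), PiLp.smul_apply, smul_eq_mul] at h
    have h' : 3 * A * (ρ * x 0) * ρ⁻¹ ^ 5 = 3 * A * ρ⁻¹ ^ 4 * x 0 := by field_simp
    have h0 : ‖x 0‖ ≤ 1 := hx ▸ PiLp.norm_apply_le x 0
    rw [h'] at h
    rw [norm_mul]
    exact (mul_le_of_le_one_left (norm_nonneg _) h0).trans h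
  rw [← integral_coord_mul_add _ hc hρ, Real.norm_eq_abs] at hbound
  set J := ∫ x, x 0 * L (ρ • x) ∂unitSphereMeasure
  have hkey : ρ ^ 4 * J - -(3 / 2) * A * m = ρ ^ 4 / 2 * (2 * J + 3 * A * ρ⁻¹ ^ 4 * m) := by
    field_simp
    ring
  rw [Real.dist_eq, hkey, abs_mul, abs_of_pos (by positivity)]
  calc ρ ^ 4 / 2 * |2 * J + 3 * A * ρ⁻¹ ^ 4 * m|
      ≤ ρ ^ 4 / 2 * (ε / (N + 1) * ρ⁻¹ ^ 4 * N) := by gcongr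
    _ = ε * (N / (2 * (N + 1))) := by field_simp
    _ < ε * 1 := by
      gcongr
      rw [div_lt_one (by positivity)]
      linarith
    _ = ε := mul_one ε

theorem tendsto_abs_atTop_of_mul_deriv {F F' : ℝ → ℝ} {ρ₀ c : ℝ}
    (hF : ∀ ρ, ρ₀ < ρ → HasDerivAt F (F' ρ) ρ)
    (hlim : Tendsto (fun ρ => ρ * F' ρ) atTop (𝓝 c)) (hc : c ≠ 0) :
    Tendsto (fun ρ => |F ρ|) atTop atTop := by
  wlog hpos : 0 < c generalizing F F' c
  · have h := this (F := fun ρ => -F ρ) (F' := fun ρ => -F' ρ) (c := -c)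
      (fun ρ hρ => (hF ρ hρ).neg) (by simpa using hlim.neg) (neg_ne_zero.2 hc)
      (neg_pos.2 (lt_of_le_of_ne (not_lt.1 hpos) hc))
    simpa using h
  obtain ⟨ρ₁, hρ₁⟩ := eventually_atTop.1 ((hlim.eventually (lt_mem_nhds (half_lt_self hpos))).and
    ((eventually_gt_atTop ρ₀).and (eventually_gt_atTop 0)))
  have hd : ∀ ρ, ρ₁ ≤ ρ → HasDerivAt (fun ρ => F ρ - c / 2 * Real.log ρ)
      (F' ρ - c / 2 * ρ⁻¹) ρ := fun ρ hρ =>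
    (hF ρ (hρ₁ ρ hρ).2.1).sub ((Real.hasDerivAt_log (hρ₁ ρ hρ).2.2.ne').const_mul _)
  have hmono : MonotoneOn (fun ρ => F ρ - c / 2 * Real.log ρ) (Set.Ici ρ₁) := by
    refine monotoneOn_of_hasDerivWithinAt_nonneg (convex_Ici ρ₁)
      (fun ρ hρ => (hd ρ hρ).continuousAt.continuousWithinAt)
      (fun ρ hρ => (hd ρ (interior_subset hρ)).hasDerivWithinAt) fun ρ hρ => ?_
    obtain ⟨h1, -, h2⟩ := hρ₁ ρ (interior_subset hρ)
    rw [sub_nonneg, ← div_eq_mul_inv, div_le_iff₀ h2]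
    linarith
  have hlog : Tendsto (fun ρ => (F ρ₁ - c / 2 * Real.log ρ₁) + c / 2 * Real.log ρ) atTop atTop :=
    tendsto_atTop_add_const_left _ _ (Real.tendsto_log_atTop.const_mul_atTop (half_pos hpos))
  refine tendsto_atTop_mono' _ ?_ hlog
  filter_upwards [eventually_ge_atTop ρ₁] with ρ hρ
  have h := hmono Set.self_mem_Ici hρ hρ
  simp only at h
  linarith [le_abs_self (F ρ)]

/-- Corollary 3.10 of the paper: for a scalar-flat metric `ḡ` with the
asymptotics `ḡ_ij = (1 + A/r)δ_ij + (x₁/r²)(x_i x_j/r² − δ_ij/2) + O₂(r^{−1−q})` and `A ≠ 0`,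
the surface integrals defining the first component of the center of mass diverge. -/
theorem center_of_mass_diverges
    (q : ℝ) (hq₁ : 1 / 2 < q) (hq₂ : q < 1)
    (ρ₀ : ℝ) (hρ₀ : 0 < ρ₀)
    (gb : E3 → Matrix (Fin 3) (Fin 3) ℝ)
    (hgreg : ∀ i j, ContDiffOn ℝ 2 (fun x => gb x i j) {x : E3 | ρ₀ ≤ ‖x‖})
    (hgpos : ∀ x : E3, ρ₀ ≤ ‖x‖ → (gb x).PosDef)
    (hgsymm : ∀ x : E3, ρ₀ ≤ ‖x‖ → (gb x).IsSymm)
    (A : ℝ) (hA : A ≠ 0)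
    (hgasymp : ∀ i j, IsO2
      (fun x => gb x i j - ((1 + A / ‖x‖) * kron i j
        + (α₉ x / ‖x‖) * (x i * x j / ‖x‖ ^ 2 - kron i j / 2))) (1 + q) ρ₀)
    (hscalarflat : ∀ x : E3, ρ₀ ≤ ‖x‖ → scalarCurvature gb x = 0) :
    Tendsto (fun ρ : ℝ => |ctmIntegral gb 0 ρ|) atTop atTop := by
  have hg : ∀ i j, ContDiffOn ℝ 2 (fun x => gb x i j) {x | ρ₀ < ‖x‖} :=
    fun i j => (hgreg i j).mono fun x (hx : ρ₀ < ‖x‖) => hx.le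
  have hO : ∀ i j, IsO2 (fun x => gb x i j - (kron i j + modelH A ‖x‖⁻¹ x i j)) (1 + q) ρ₀ := by
    intro i j
    convert hgasymp i j using 3 with x
    simp only [modelH, sigmaH, α₉]
    ring
  have happrox := approx_linForm_metricHess hρ₀.le (by linarith) hg
    (fun x hx => (hgpos x hx.le).det_pos.ne') (fun x hx => hgsymm x hx.le) hO
    (fun x hx => hscalarflat x hx.le)
  have hlim := tendsto_pow_mul_integral (continuousOn_linForm_metricHess hg)
    (isLittleO_linForm_sub_neg happrox)
  have hflux := tendsto_abs_atTop_of_mul_deriv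
    (fun ρ hρ => hasDerivAt_flux (contDiffOn_fluxField hg) hρ₀.le hρ)
    (hlim.congr' ?_) (by simp [hA, (integral_coord_sq_pos 0).ne'])
  · refine hflux.congr' ?_
    filter_upwards [eventually_gt_atTop 0] with ρ hρ
    rw [ctmIntegral_eq_flux gb hρ]
  · filter_upwards [eventually_gt_atTop ρ₀] with ρ hρ
    have h : ∫ x, ∑ j, pd (fluxField gb j) j (ρ • x) ∂unitSphereMeasure =
        ∫ x, ρ * (x 0 * linForm (metricHess gb (ρ • x))) ∂unitSphereMeasure := by
      refine integral_congr_ae ?_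
      filter_upwards [ae_norm_eq_one] with x hx
      have hn : ρ₀ < ‖ρ • x‖ := by
        rw [norm_smul, hx, mul_one]
        exact hρ.trans_le (le_abs_self ρ)
      rw [sum_pd_fluxField hg hn, PiLp.smul_apply, smul_eq_mul, mul_assoc]
    rw [h, integral_const_mul]
    ring
end
end

section
/- Define on ℝ³∖{0} the symmetric 2-tensor τ_ij(x) = r^{−2} δ_ij + x_i x_j r^{−4}(2 log r − 1), where r = |x| (this is the tensor (|∇u|² + uΔu)δ_ij − (∂_i u ∂_j u + u ∂_i∂_j u) for u = log r). Then Σ_i ∂_i τ_ij = 0 at every point of ℝ³∖{0}, for each j = 1,2,3. -/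
noncomputable section

/-- The tensor `τ_ij(x) = r^{−2}δ_ij + x_i x_j r^{−4}(2 log r − 1)`, which is
`(|∇u|² + uΔu)δ_ij − (∂_i u ∂_j u + u ∂_i∂_j u)` for `u = log r`. -/
def tauLog (i j : Fin 3) (x : E3) : ℝ :=
  kron i j / ‖x‖ ^ 2 + x i * x j / ‖x‖ ^ 4 * (2 * Real.log ‖x‖ - 1)

theorem tauLog_eq_norm_sq (i j : Fin 3) (x : E3) :
    tauLog i j x =
      kron i j / ‖x‖ ^ 2 + x i * x j / (‖x‖ ^ 2) ^ 2 * (Real.log (‖x‖ ^ 2) - 1) := by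
  rw [tauLog, Real.log_pow, ← pow_mul]
  norm_num

theorem pd_tauLog {x : E3} (hx : x ≠ 0) (i j k : Fin 3) :
    pd (fun y => tauLog i j y) k x =
      -(2 * kron i j * x k) / ‖x‖ ^ 4
        + (kron i k * x j + x i * kron j k) / ‖x‖ ^ 4 * (Real.log (‖x‖ ^ 2) - 1)
        + x i * x j * x k / ‖x‖ ^ 6 * (6 - 4 * Real.log (‖x‖ ^ 2)) := by
  have hs : ‖x‖ ^ 2 ≠ 0 := by simpa using hx
  have hn : ‖x‖ ≠ 0 := by simpa using hx
  have hsq : HasFDerivAt (fun y : E3 => ‖y‖ ^ 2) (2 • innerSL ℝ x) x :=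
    (hasStrictFDerivAt_norm_sq x).hasFDerivAt
  have hcoord (l : Fin 3) :
      HasFDerivAt (fun y : E3 => y l) (EuclideanSpace.proj l : E3 →L[ℝ] ℝ) x :=
    (EuclideanSpace.proj l : E3 →L[ℝ] ℝ).hasFDerivAt
  have hinv : HasFDerivAt (fun y : E3 => (‖y‖ ^ 2)⁻¹) _ x :=
    (hasDerivAt_inv hs).comp_hasFDerivAt x hsq
  have h := (hinv.const_mul (kron i j)).add
    ((((hcoord i).mul (hcoord j)).mul (hinv.pow 2)).mul ((hsq.log hs).sub_const 1))
  have heq : (fun y => tauLog i j y) = fun y : E3 => kron i j * (‖y‖ ^ 2)⁻¹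
      + y i * y j * (‖y‖ ^ 2)⁻¹ ^ 2 * (Real.log (‖y‖ ^ 2) - 1) := by
    funext y
    rw [tauLog_eq_norm_sq, div_eq_mul_inv, div_eq_mul_inv, inv_pow (‖y‖ ^ 2)]
  have hsingle (l : Fin 3) : (EuclideanSpace.single k (1 : ℝ) : E3) l = kron l k := by
    simp [kron]
  have hinner : inner ℝ x (EuclideanSpace.single k (1 : ℝ)) = x k := by
    simp [EuclideanSpace.inner_single_right]
  rw [pd, heq]
  erw [h.fderiv]
  simp [hsingle, hinner, -PiLp.single_apply]
  field_simp
  ring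

/-- the tensor `τ_ij = r^{−2}δ_ij + x_i x_j r^{−4}(2 log r − 1)` is
divergence free on `ℝ³∖{0}`: `Σ_i ∂_i τ_ij = 0` for each `j`. -/
theorem tauLog_divergence_free :
    ∀ x : E3, x ≠ 0 → ∀ j : Fin 3, ∑ i, pd (fun y => tauLog i j y) i x = 0 := by
  intro x hx j
  have hn : ‖x‖ ≠ 0 := by simpa using hx
  have hs : ‖x‖ ^ 2 = x 0 ^ 2 + x 1 ^ 2 + x 2 ^ 2 := by
    simp [EuclideanSpace.real_norm_sq_eq, Fin.sum_univ_three]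
  simp only [pd_tauLog hx, Fin.sum_univ_three]
  generalize Real.log (‖x‖ ^ 2) = L
  field_simp
  fin_cases j <;> simp [kron] <;> rw [hs] <;> ring
end
end

section
/- Let q ∈ (1/2,1) and let w be a C² function on {x ∈ ℝ³ : |x| ≥ 1} such that |w(x)| ≤ C|x|^{−q} and |Δw(x)| ≤ C|x|^{−2−2q} for some constant C, where Δ is the Euclidean Laplacian. Then there exist a constant a ∈ ℝ and a constant C′ such that |w(x) − a/|x|| ≤ C′|x|^{−2q} for all |x| ≥ 2. -/
noncomputable section

/-- The Euclidean Laplacian `Δf = Σ_i ∂_i∂_i f`. -/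
def lap (f : E3 → ℝ) (x : E3) : ℝ := ∑ i, pd (pd f i) i x

open Filter Topology

/-! ### Calculus of `pd` and `lap` -/

theorem differentiableAt_pd {f : E3 → ℝ} {x : E3} (hf : ContDiffAt ℝ 2 f x) (i : Fin 3) :
    DifferentiableAt ℝ (pd f i) x :=
  ((hf.fderiv_right (m := 1) (by norm_num)).differentiableAt one_ne_zero).clm_apply
    (differentiableAt_const _)

theorem eventually_differentiableAt {f : E3 → ℝ} {x : E3} (hf : ContDiffAt ℝ 2 f x) :
    ∀ᶠ y in 𝓝 x, DifferentiableAt ℝ f y :=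
  (hf.eventually (by simp)).mono fun _ hy => hy.differentiableAt two_ne_zero

theorem pd_congr {f g : E3 → ℝ} {x : E3} (h : f =ᶠ[𝓝 x] g) (i : Fin 3) :
    pd f i x = pd g i x := by
  rw [pd, pd, h.fderiv_eq]

theorem pd_add {f g : E3 → ℝ} {x : E3} (hf : DifferentiableAt ℝ f x)
    (hg : DifferentiableAt ℝ g x) (i : Fin 3) :
    pd (fun y => f y + g y) i x = pd f i x + pd g i x := by
  simp [pd, fderiv_fun_add hf hg]

theorem pd_mul {f g : E3 → ℝ} {x : E3} (hf : DifferentiableAt ℝ f x)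
    (hg : DifferentiableAt ℝ g x) (i : Fin 3) :
    pd (fun y => f y * g y) i x = f x * pd g i x + g x * pd f i x := by
  simp [pd, fderiv_fun_mul hf hg]

theorem lap_add {f g : E3 → ℝ} {x : E3} (hf : ContDiffAt ℝ 2 f x) (hg : ContDiffAt ℝ 2 g x) :
    lap (fun y => f y + g y) x = lap f x + lap g x := by
  simp only [lap, ← Finset.sum_add_distrib]
  refine Finset.sum_congr rfl fun i _ => ?_
  rw [← pd_add (differentiableAt_pd hf i) (differentiableAt_pd hg i)]
  refine pd_congr ?_ i
  filter_upwards [eventually_differentiableAt hf, eventually_differentiableAt hg] with y h₁ h₂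
    using pd_add h₁ h₂ i

theorem lap_mul {f g : E3 → ℝ} {x : E3} (hf : ContDiffAt ℝ 2 f x) (hg : ContDiffAt ℝ 2 g x) :
    lap (fun y => f y * g y) x =
      f x * lap g x + 2 * ∑ i, pd f i x * pd g i x + g x * lap f x := by
  simp only [lap, Finset.mul_sum, ← Finset.sum_add_distrib]
  refine Finset.sum_congr rfl fun i _ => ?_
  have hf' := hf.differentiableAt two_ne_zero
  have hg' := hg.differentiableAt two_ne_zero
  have h : pd (fun y => f y * g y) i =ᶠ[𝓝 x] fun y => f y * pd g i y + g y * pd f i y := by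
    filter_upwards [eventually_differentiableAt hf, eventually_differentiableAt hg] with y h₁ h₂
      using pd_mul h₁ h₂ i
  rw [pd_congr h,
    pd_add (hf'.fun_mul (differentiableAt_pd hg i)) (hg'.fun_mul (differentiableAt_pd hf i)),
    pd_mul hf' (differentiableAt_pd hg i), pd_mul hg' (differentiableAt_pd hf i)]
  ring

theorem pd_const (c : ℝ) (i : Fin 3) : pd (fun _ => c) i = fun _ => 0 := by
  ext x
  simp [pd]

theorem lap_const (c : ℝ) (x : E3) : lap (fun _ => c) x = 0 := by
  simp [lap, pd_const]

theorem lap_const_mul {f : E3 → ℝ} {x : E3} (c : ℝ) (hf : ContDiffAt ℝ 2 f x) :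
    lap (fun y => c * f y) x = c * lap f x := by
  simp [lap_mul contDiffAt_const hf, lap_const, pd_const]

theorem lap_eq_sum_fderiv_fderiv {f : E3 → ℝ} {x : E3} (hf : ContDiffAt ℝ 2 f x) :
    lap f x = ∑ i : Fin 3, fderiv ℝ (fderiv ℝ f) x (EuclideanSpace.single i 1)
      (EuclideanSpace.single i 1) := by
  refine Finset.sum_congr rfl fun i _ => ?_
  have h := (hf.fderiv_right (m := 1) (by norm_num)).differentiableAt one_ne_zero
  have hpd : pd f i = fun y => fderiv ℝ f y (EuclideanSpace.single i 1) := rfl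
  rw [pd, hpd, fderiv_clm_apply h (differentiableAt_const _)]
  simp

open Laplacian InnerProductSpace in
theorem lap_eq_laplacian {f : E3 → ℝ} {x : E3} (hf : ContDiffAt ℝ 2 f x) :
    lap f x = Δ f x := by
  rw [lap_eq_sum_fderiv_fderiv hf,
    laplacian_eq_iteratedFDeriv_orthonormalBasis f (EuclideanSpace.basisFun (Fin 3) ℝ)]
  simp [iteratedFDeriv_two_apply]

/-- The Laplacian is invariant under linear isometries. -/
theorem lap_comp_linearIsometryEquiv (σ : E3 ≃ₗᵢ[ℝ] E3) {f : E3 → ℝ} {x : E3}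
    (hf : ContDiffAt ℝ 2 f (σ x)) : lap (fun y => f (σ y)) x = lap f (σ x) := by
  have hc : ContDiffAt ℝ 2 (fun y => f (σ y)) x := hf.comp x σ.contDiff.contDiffAt
  have hfσ : fderiv ℝ (fun y => f (σ y)) =ᶠ[𝓝 x]
      fun y => (fderiv ℝ f (σ y)).comp (σ.toContinuousLinearEquiv : E3 →L[ℝ] E3) := by
    filter_upwards [σ.continuous.continuousAt.eventually (eventually_differentiableAt hf)]
      with y hy
    exact (hy.hasFDerivAt.comp y σ.toContinuousLinearEquiv.hasFDerivAt).fderiv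
  have h := (hf.fderiv_right (m := 1) (by norm_num)).differentiableAt one_ne_zero
  have h2 := (h.hasFDerivAt.comp x σ.toContinuousLinearEquiv.hasFDerivAt).clm_comp
    (hasFDerivAt_const (σ.toContinuousLinearEquiv : E3 →L[ℝ] E3) x)
  rw [lap_eq_sum_fderiv_fderiv hc, hfσ.fderiv_eq, lap_eq_laplacian hf,
    InnerProductSpace.laplacian_eq_iteratedFDeriv_orthonormalBasis f
      ((EuclideanSpace.basisFun (Fin 3) ℝ).map σ)]
  refine Finset.sum_congr rfl fun i _ => ?_
  erw [h2.fderiv]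
  simp [iteratedFDeriv_two_apply]

/-! ### The maximum principle -/

theorem deriv_deriv_nonpos_of_isLocalMax {g : ℝ → ℝ} {t : ℝ} (hg : ContinuousAt g t)
    (hmax : IsLocalMax g t) : deriv (deriv g) t ≤ 0 := by
  by_contra! hpos
  have hmin := isLocalMin_of_deriv_deriv_pos hpos hmax.deriv_eq_zero hg
  have hconst : g =ᶠ[𝓝 t] fun _ => g t := by
    filter_upwards [hmax, hmin] with s h₁ h₂ using le_antisymm h₁ h₂
  have h := hconst.deriv.deriv_eq
  simp at h
  linarith

theorem lap_nonpos_of_isLocalMax {f : E3 → ℝ} {x : E3} (hf : ContDiffAt ℝ 2 f x)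
    (hmax : IsLocalMax f x) : lap f x ≤ 0 := by
  refine Finset.sum_nonpos fun i _ => ?_
  set e : E3 := EuclideanSpace.single i 1
  have hline (t : ℝ) : HasDerivAt (fun s : ℝ => x + s • e) e t := by
    simpa using ((hasDerivAt_id t).smul_const e).const_add x
  have hx : x + (0 : ℝ) • e = x := by simp
  have hcont : Tendsto (fun s : ℝ => x + s • e) (𝓝 0) (𝓝 x) := by
    simpa using (hline 0).continuousAt.tendsto
  have hderiv : deriv (fun s : ℝ => f (x + s • e)) =ᶠ[𝓝 0] fun s => pd f i (x + s • e) := by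
    filter_upwards [hcont.eventually (eventually_differentiableAt hf)] with s hs
    exact (hs.hasFDerivAt.comp_hasDerivAt s (hline s)).deriv
  have hderiv2 : deriv (fun s : ℝ => pd f i (x + s • e)) 0 = pd (pd f i) i x := by
    have h := (differentiableAt_pd hf i).hasFDerivAt
    exact (HasFDerivAt.comp_hasDerivAt_of_eq 0 h (hline 0) hx.symm).deriv
  rw [← hderiv2, ← hderiv.deriv_eq]
  refine deriv_deriv_nonpos_of_isLocalMax ?_ ?_
  · refine ContinuousAt.comp_of_eq ?_ (hline 0).continuousAt hx
    exact hf.continuousAt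
  · filter_upwards [hcont.eventually hmax] with s hs
    simpa using hs

/-- A function on a closed set that decays at infinity is nonpositive if it is strictly subharmonic
near its positive values. -/
theorem nonpos_of_lap_pos {D : Set E3} (hD : IsClosed D) {v : E3 → ℝ} (hv : ContinuousOn v D)
    {q K : ℝ} (hq : 0 < q) (hK : ∀ x ∈ D, v x ≤ K * ‖x‖ ^ (-q))
    (hpos : ∀ x ∈ D, 0 < v x → D ∈ 𝓝 x ∧ ContDiffAt ℝ 2 v x ∧ 0 < lap v x) :
    ∀ x ∈ D, v x ≤ 0 := by
  intro x₀ hx₀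
  by_contra! h₀
  have hlim : Tendsto (fun r : ℝ => K * r ^ (-q)) atTop (𝓝 0) := by
    simpa using (tendsto_rpow_neg_atTop hq).const_mul K
  obtain ⟨M, hM⟩ := eventually_atTop.1 (hlim.eventually (gt_mem_nhds h₀))
  set S : Set E3 := D ∩ v ⁻¹' Set.Ici (v x₀)
  have hS : IsCompact S := by
    refine Metric.isCompact_of_isClosed_isBounded
      (hv.preimage_isClosed_of_isClosed hD isClosed_Ici) ?_
    refine (Metric.isBounded_closedBall (x := (0 : E3)) (r := M)).subset fun y hy => ?_
    rw [mem_closedBall_zero_iff]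
    by_contra! hlt
    exact (((hK y hy.1).trans_lt (hM _ hlt.le)).trans_le hy.2).false
  obtain ⟨x, hxS, hmax⟩ := hS.exists_isMaxOn ⟨x₀, hx₀, le_refl (v x₀)⟩
    (hv.mono Set.inter_subset_left)
  obtain ⟨hnhds, hcd, hlap⟩ := hpos x hxS.1 (h₀.trans_le hxS.2)
  refine hlap.not_ge (lap_nonpos_of_isLocalMax hcd ?_)
  filter_upwards [hnhds] with y hy
  by_cases h : v x₀ ≤ v y
  · exact hmax ⟨hy, h⟩
  · exact (not_le.1 h).le.trans hxS.2

/-! ### Barriers -/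

theorem hasFDerivAt_norm_rpow_of_ne_zero {x : E3} (hx : x ≠ 0) (p : ℝ) :
    HasFDerivAt (fun y : E3 => ‖y‖ ^ p) ((p * ‖x‖ ^ (p - 2)) • innerSL ℝ x) x := by
  apply HasStrictFDerivAt.hasFDerivAt
  convert! (hasStrictFDerivAt_norm_sq x).rpow_const (p := p / 2) (by simp [hx]) using 0
  simp_rw [← Real.rpow_natCast_mul (norm_nonneg _), ← Nat.cast_smul_eq_nsmul ℝ, smul_smul]
  ring_nf

theorem contDiffAt_norm_rpow {x : E3} (hx : x ≠ 0) (p : ℝ) :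
    ContDiffAt ℝ 2 (fun y : E3 => ‖y‖ ^ p) x :=
  (contDiffAt_norm ℝ hx).rpow_const_of_ne (norm_ne_zero_iff.2 hx)

theorem pd_norm_rpow {x : E3} (hx : x ≠ 0) (p : ℝ) (i : Fin 3) :
    pd (fun y : E3 => ‖y‖ ^ p) i x = p * ‖x‖ ^ (p - 2) * x i := by
  simp [pd, (hasFDerivAt_norm_rpow_of_ne_zero hx p).fderiv, EuclideanSpace.inner_single_right]

theorem lap_norm_rpow {x : E3} (hx : x ≠ 0) (p : ℝ) :
    lap (fun y : E3 => ‖y‖ ^ p) x = p * (p + 1) * ‖x‖ ^ (p - 2) := by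
  have hcoord (i : Fin 3) : HasFDerivAt (fun y : E3 => y i)
      (EuclideanSpace.proj i : E3 →L[ℝ] ℝ) x :=
    (EuclideanSpace.proj i : E3 →L[ℝ] ℝ).hasFDerivAt
  have h (i : Fin 3) : pd (pd (fun y : E3 => ‖y‖ ^ p) i) i x =
      p * ‖x‖ ^ (p - 2) + p * (p - 2) * ‖x‖ ^ (p - 4) * x i ^ 2 := by
    have he : pd (fun y : E3 => ‖y‖ ^ p) i =ᶠ[𝓝 x] fun y => p * ‖y‖ ^ (p - 2) * y i := by
      filter_upwards [isOpen_ne.mem_nhds hx] with y hy using pd_norm_rpow hy p i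
    have hd := (hasFDerivAt_norm_rpow_of_ne_zero hx (p - 2)).const_mul p
    rw [pd_congr he, pd_mul hd.differentiableAt (hcoord i).differentiableAt, pd, pd, hd.fderiv,
      (hcoord i).fderiv]
    simp [EuclideanSpace.inner_single_right]
    ring_nf
  have hs : ‖x‖ ^ (p - 2) = ‖x‖ ^ (p - 4) * ∑ i, x i ^ 2 := by
    rw [← EuclideanSpace.real_norm_sq_eq, ← Real.rpow_natCast, ← Real.rpow_add (norm_pos_iff.2 hx)]
    norm_num
    ring_nf
  simp only [lap, h, Finset.sum_add_distrib, ← Finset.mul_sum]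
  simp only [Finset.sum_const, Finset.card_univ, Fintype.card_fin, nsmul_eq_mul]
  linear_combination (- p * (p - 2)) * hs

theorem pd_inner (n x : E3) (i : Fin 3) : pd (fun y => inner ℝ n y) i x = n i := by
  have h : HasFDerivAt (fun y => inner ℝ n y) (innerSL ℝ n) x := (innerSL ℝ n).hasFDerivAt
  simp [pd, h.fderiv, EuclideanSpace.inner_single_right]

theorem contDiff_inner_left (n : E3) : ContDiff ℝ 2 (fun y : E3 => inner ℝ n y) :=
  contDiff_const.inner ℝ contDiff_id

theorem lap_inner (n x : E3) : lap (fun y => inner ℝ n y) x = 0 := by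
  have h (i : Fin 3) : pd (fun y => inner ℝ n y) i = fun _ => n i := funext fun y => pd_inner n y i
  simp [lap, h, pd_const]

theorem lap_inner_mul_norm_rpow (n : E3) {x : E3} (hx : x ≠ 0) (p : ℝ) :
    lap (fun y => inner ℝ n y * ‖y‖ ^ p) x = p * (p + 3) * inner ℝ n x * ‖x‖ ^ (p - 2) := by
  have h : ∑ i, n i * x i = inner ℝ n x := by
    simp [PiLp.inner_apply, mul_comm]
  rw [lap_mul (contDiff_inner_left n).contDiffAt (contDiffAt_norm_rpow hx p), lap_inner,
    lap_norm_rpow hx]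
  simp only [pd_inner, pd_norm_rpow hx]
  rw [← h, Finset.sum_congr rfl fun i _ => show n i * (p * ‖x‖ ^ (p - 2) * x i) =
    (p * ‖x‖ ^ (p - 2)) * (n i * x i) by ring, ← Finset.mul_sum]
  ring

theorem lap_inner_sq_mul_norm_rpow {n : E3} (hn : ‖n‖ = 1) {x : E3} (hx : x ≠ 0) (p : ℝ) :
    lap (fun y => inner ℝ n y * (inner ℝ n y * ‖y‖ ^ p)) x =
      2 * ‖x‖ ^ p + p * (p + 5) * inner ℝ n x ^ 2 * ‖x‖ ^ (p - 2) := by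
  have h : ∑ i, n i * x i = inner ℝ n x := by
    simp [PiLp.inner_apply, mul_comm]
  have hn' : ∑ i, n i ^ 2 = 1 := by
    rw [← EuclideanSpace.real_norm_sq_eq, hn, one_pow]
  have hc := (contDiff_inner_left n).contDiffAt (x := x)
  have hp := contDiffAt_norm_rpow hx p
  rw [lap_mul hc (hc.mul hp), lap_inner, lap_inner_mul_norm_rpow n hx]
  have hpd (i : Fin 3) : pd (fun y => inner ℝ n y * ‖y‖ ^ p) i x =
      inner ℝ n x * (p * ‖x‖ ^ (p - 2) * x i) + ‖x‖ ^ p * n i := by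
    rw [pd_mul (hc.differentiableAt two_ne_zero) (hp.differentiableAt two_ne_zero), pd_inner,
      pd_norm_rpow hx]
  simp only [pd_inner, hpd]
  rw [Finset.sum_congr rfl fun i _ => show
      n i * (inner ℝ n x * (p * ‖x‖ ^ (p - 2) * x i) + ‖x‖ ^ p * n i) =
    (inner ℝ n x * p * ‖x‖ ^ (p - 2)) * (n i * x i) + ‖x‖ ^ p * n i ^ 2 by ring,
    Finset.sum_add_distrib, ← Finset.mul_sum, ← Finset.mul_sum, h, hn']
  ring

/-- On every half-space through the origin there is a positive strictly superharmonic function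
comparable to `‖x‖ ^ (-s)`, for `1 < s < 2`. -/
theorem exists_halfSpace_barrier {s : ℝ} (hs₁ : 1 < s) (hs₂ : s < 2) :
    ∃ δ > 0, ∃ ε > 0, ∀ n : E3, ‖n‖ = 1 → ∃ φ : E3 → ℝ, ∀ x : E3, x ≠ 0 →
      ContDiffAt ℝ 2 φ x ∧ (0 ≤ inner ℝ n x →
        lap φ x ≤ -δ * ‖x‖ ^ (-(2 + s)) ∧
        ε * ‖x‖ ^ (-s) ≤ φ x ∧ φ x ≤ 2 * ‖x‖ ^ (-s)) := by
  obtain ⟨δ, hδ⟩ : ∃ δ : ℝ, 3 * δ = 2 - s := ⟨(2 - s) / 3, by ring⟩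
  refine ⟨δ, by linarith, δ / 2, by linarith, fun n hn => ⟨fun y =>
    inner ℝ n y * ‖y‖ ^ (-s - 1) + (-δ) * (inner ℝ n y * (inner ℝ n y * ‖y‖ ^ (-s - 2))) +
      (δ / 2) * ‖y‖ ^ (-s), fun x hx => ?_⟩⟩
  have hl := (contDiff_inner_left n).contDiffAt (x := x)
  have h₁ : ContDiffAt ℝ 2 (fun y : E3 => inner ℝ n y * ‖y‖ ^ (-s - 1)) x :=
    hl.mul (contDiffAt_norm_rpow hx _)
  have h₂ : ContDiffAt ℝ 2 (fun y : E3 => inner ℝ n y * (inner ℝ n y * ‖y‖ ^ (-s - 2))) x :=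
    hl.mul (hl.mul (contDiffAt_norm_rpow hx _))
  have h₃ := contDiffAt_norm_rpow hx (-s)
  have h₂' : ContDiffAt ℝ 2
      (fun y : E3 => (-δ) * (inner ℝ n y * (inner ℝ n y * ‖y‖ ^ (-s - 2)))) x :=
    contDiffAt_const.mul h₂
  have h₃' : ContDiffAt ℝ 2 (fun y : E3 => (δ / 2) * ‖y‖ ^ (-s)) x := contDiffAt_const.mul h₃
  refine ⟨(h₁.add h₂').add h₃', fun hnx => ?_⟩
  have hr : 0 < ‖x‖ := norm_pos_iff.2 hx
  obtain ⟨t, ht⟩ : ∃ t, inner ℝ n x = t * ‖x‖ := ⟨inner ℝ n x / ‖x‖, by field_simp⟩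
  have ht₀ : 0 ≤ t := by
    rw [ht] at hnx
    exact nonneg_of_mul_nonneg_left hnx hr
  have ht₁ : t ≤ 1 := by
    have := real_inner_le_norm n x
    rw [hn, ht] at this
    exact le_of_mul_le_mul_right this hr
  have hpow (a : ℝ) : ‖x‖ ^ a = ‖x‖ * ‖x‖ ^ (a - 1) := by
    rw [Real.rpow_sub_one hr.ne']
    field_simp
  refine ⟨?_, ?_⟩
  · rw [lap_add (h₁.add h₂') h₃', lap_add h₁ h₂', lap_const_mul _ h₂, lap_const_mul _ h₃,
      lap_inner_mul_norm_rpow n hx, lap_inner_sq_mul_norm_rpow hn hx, lap_norm_rpow hx]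
    have e₁ := hpow (-(2 + s))
    have e₂ := hpow (-(2 + s) - 1)
    have e₃ : ‖x‖ ^ (-s - 1 - 2) = ‖x‖ ^ (-(2 + s) - 1) := by ring_nf
    have e₄ : ‖x‖ ^ (-s - 2) = ‖x‖ ^ (-(2 + s)) := by ring_nf
    have e₅ : ‖x‖ ^ (-s - 2 - 2) = ‖x‖ ^ (-(2 + s) - 1 - 1) := by ring_nf
    rw [e₃, e₄, e₅, ht]
    have hP : 0 < ‖x‖ ^ (-(2 + s)) := Real.rpow_pos_of_pos hr _
    have hs : s = 2 - 3 * δ := by linarith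
    have key : (s + 1) * (s - 2) * t - 2 * δ + δ * ((s + 2) * (3 - s)) * t ^ 2
        + δ / 2 * (s * (s - 1)) ≤ -δ := by
      subst hs
      have hδ₀ : 0 < δ := by linarith
      have hδ₁ : 3 * δ < 1 := by linarith
      have htt : t ^ 2 ≤ t := by nlinarith
      have a₁ : δ * ((2 - 3 * δ + 2) * (3 - (2 - 3 * δ))) * t ^ 2 ≤
          δ * ((2 - 3 * δ + 2) * (3 - (2 - 3 * δ))) * t := by
        refine mul_le_mul_of_nonneg_left htt ?_
        exact mul_nonneg hδ₀.le (mul_nonneg (by linarith) (by linarith))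
      have a₂ : 0 ≤ δ * t * (5 - 18 * δ + 9 * δ ^ 2) := by
        refine mul_nonneg (mul_nonneg hδ₀.le ht₀) ?_
        nlinarith
      have a₃ : 0 ≤ δ * (δ * (1 - δ)) :=
        mul_nonneg hδ₀.le (mul_nonneg hδ₀.le (by linarith))
      nlinarith
    have := mul_le_mul_of_nonneg_right key hP.le
    refine le_trans (le_of_eq ?_) this
    linear_combination (- (s + 1) * (s - 2) * t - δ * ((s + 2) * (3 - s)) * t ^ 2) * e₁
      - δ * ((s + 2) * (3 - s)) * t ^ 2 * ‖x‖ * e₂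
  · have e₁ := hpow (-s)
    have e₂ := hpow (-s - 1)
    have e₃ : ‖x‖ ^ (-s - 2) = ‖x‖ ^ (-s - 1 - 1) := by ring_nf
    have hP : 0 < ‖x‖ ^ (-s) := Real.rpow_pos_of_pos hr _
    have hval : t * ‖x‖ * ‖x‖ ^ (-s - 1) + -δ * (t * ‖x‖ * (t * ‖x‖ * ‖x‖ ^ (-s - 2)))
        + δ / 2 * ‖x‖ ^ (-s) = (t - δ * t ^ 2 + δ / 2) * ‖x‖ ^ (-s) := by
      rw [e₃]
      linear_combination (-t + δ * t ^ 2) * e₁ + δ * t ^ 2 * ‖x‖ * e₂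
    simp only [ht, hval]
    constructor <;> refine mul_le_mul_of_nonneg_right ?_ hP.le <;> nlinarith

/-! ### Comparison with the barriers -/

theorem rpow_le_rpow_of_two_le {r p p' : ℝ} (hr : 2 ≤ r) (h : p ≤ p') : r ^ p ≤ r ^ p' :=
  Real.rpow_le_rpow_of_exponent_le (by linarith) h

theorem ne_zero_of_two_le_norm {x : E3} (hx : 2 ≤ ‖x‖) : x ≠ 0 :=
  norm_pos_iff.1 (by linarith)

/-- The oscillation on spheres is controlled by comparing the function with its reflections. -/
theorem exists_oscillation_bound {q s C : ℝ} (hq : 0 < q) (hs₁ : 1 < s) (hs₂ : s < 2) (hC : 0 ≤ C)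
    {w : E3 → ℝ} (hw : ∀ x, 2 ≤ ‖x‖ → ContDiffAt ℝ 2 w x)
    (hb : ∀ x, 2 ≤ ‖x‖ → |w x| ≤ C * ‖x‖ ^ (-q))
    (hl : ∀ x, 2 ≤ ‖x‖ → |lap w x| ≤ C * ‖x‖ ^ (-(2 + s))) :
    ∃ K ≥ 0, ∀ x y : E3, 2 ≤ ‖x‖ → ‖x‖ = ‖y‖ → w x - w y ≤ K * ‖x‖ ^ (-s) := by
  obtain ⟨δ, hδ, ε, hε, hφ⟩ := exists_halfSpace_barrier hs₁ hs₂
  have h2s : (0 : ℝ) < 2 ^ (-s) := by positivity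
  set A : ℝ := (2 * C + 1) / δ + 2 * C * 2 ^ (-q) / (ε * 2 ^ (-s))
  have hA₀ : 0 ≤ A := by positivity
  have hA₁ : 2 * C < A * δ := by
    have : A * δ = 2 * C + 1 + 2 * C * 2 ^ (-q) / (ε * 2 ^ (-s)) * δ := by
      simp only [A]
      field_simp
    have : 0 ≤ 2 * C * 2 ^ (-q) / (ε * 2 ^ (-s)) * δ := by positivity
    linarith
  have hA₂ : 2 * C * 2 ^ (-q) ≤ A * (ε * 2 ^ (-s)) := by
    have : A * (ε * 2 ^ (-s)) = (2 * C + 1) / δ * (ε * 2 ^ (-s)) + 2 * C * 2 ^ (-q) := by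
      simp only [A]
      field_simp
    have : 0 ≤ (2 * C + 1) / δ * (ε * 2 ^ (-s)) := by positivity
    linarith
  refine ⟨2 * A, by positivity, fun x y hx hxy => ?_⟩
  rcases eq_or_ne x y with rfl | hne
  · rw [sub_self]
    positivity
  have hxy₀ : 0 < ‖x - y‖ := norm_pos_iff.2 (sub_ne_zero.2 hne)
  set n : E3 := ‖x - y‖⁻¹ • (x - y)
  have hn : ‖n‖ = 1 := by
    simp only [n, norm_smul, norm_inv, norm_norm]
    field_simp
  set σ : E3 ≃ₗᵢ[ℝ] E3 := Submodule.reflection (ℝ ∙ (x - y))ᗮ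
  have hσx : σ x = y := Submodule.reflection_sub hxy
  have hσ_fix (z : E3) (hz : inner ℝ n z = 0) : σ z = z := by
    refine Submodule.reflection_mem_subspace_eq_self ?_
    rw [Submodule.mem_orthogonal_singleton_iff_inner_right]
    simpa [n, inner_smul_left, hxy₀.ne'] using hz
  have hnx : 0 ≤ inner ℝ n x := by
    have h₁ := real_inner_le_norm y x
    rw [← hxy] at h₁
    have h₂ := real_inner_self_eq_norm_mul_norm x
    simp only [n, inner_smul_left, inner_sub_left]
    exact mul_nonneg (by simp) (by linarith)
  obtain ⟨φ, hφ⟩ := hφ n hn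
  have hcd (z : E3) (hz : 2 ≤ ‖z‖) : ContDiffAt ℝ 2 (fun y => w (σ y)) z :=
    (hw (σ z) (by simpa using hz)).comp z σ.contDiff.contDiffAt
  have hu (z : E3) (hz : 2 ≤ ‖z‖) : w z - w (σ z) ≤ 2 * C * ‖z‖ ^ (-q) := by
    have h₁ := abs_le.1 (hb z hz)
    have h₂ := abs_le.1 (hb (σ z) (by simpa using hz))
    rw [σ.norm_map] at h₂
    linarith [h₁.2, h₂.1]
  set v : E3 → ℝ := fun z => w z + ((-1) * w (σ z) + (-A) * φ z)
  have hv (z : E3) (hz : 2 ≤ ‖z‖) : ContDiffAt ℝ 2 v z :=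
    (hw z hz).add ((contDiffAt_const.mul (hcd z hz)).add
      (contDiffAt_const.mul (hφ z (ne_zero_of_two_le_norm hz)).1))
  have hnonpos := nonpos_of_lap_pos (D := {z : E3 | 2 ≤ ‖z‖} ∩ {z | 0 ≤ inner ℝ n z})
    (v := v) (q := q) (K := 2 * C)
    ((isClosed_le continuous_const continuous_norm).inter
      (isClosed_le continuous_const (contDiff_inner_left n).continuous))
    (fun z hz => (hv z hz.1).continuousAt.continuousWithinAt) hq ?_ ?_ x ⟨hx, hnx⟩
  · have := ((hφ x (ne_zero_of_two_le_norm hx)).2 hnx).2.2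
    simp only [v, hσx] at hnonpos
    nlinarith
  · rintro z ⟨hz, hnz⟩
    have h₁ := ((hφ z (ne_zero_of_two_le_norm hz)).2 hnz).2.1
    have h₂ : 0 ≤ φ z := le_trans (by positivity) h₁
    have := mul_nonneg hA₀ h₂
    have := hu z hz
    simp only [v]
    linarith
  · rintro z ⟨hz, hnz⟩ hvz
    have hz' : 2 ≤ ‖z‖ := hz
    have hz₀ := ne_zero_of_two_le_norm hz
    obtain ⟨hlφ, hφz, -⟩ := (hφ z hz₀).2 hnz
    have hφ₀ : 0 ≤ A * φ z := mul_nonneg hA₀ (le_trans (by positivity) hφz)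
    refine ⟨?_, hv z hz, ?_⟩
    · have hlt : 2 < ‖z‖ := by
        refine lt_of_le_of_ne hz fun heq => ?_
        have := hu z hz
        rw [← heq] at this hφz
        have := mul_le_mul_of_nonneg_left hφz hA₀
        simp only [v] at hvz
        linarith
      have hlt' : 0 < inner ℝ n z := by
        refine lt_of_le_of_ne hnz fun heq => ?_
        simp only [v, hσ_fix z heq.symm] at hvz
        linarith
      filter_upwards [continuous_norm.continuousAt.eventually (lt_mem_nhds hlt),
        (contDiff_inner_left n).continuous.continuousAt.eventually (lt_mem_nhds hlt')]
        with p h₁ h₂ using ⟨h₁.le, h₂.le⟩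
    · have hP : 0 < ‖z‖ ^ (-(2 + s)) := by positivity
      have h₁ := abs_le.1 (hl z hz)
      have h₂ := abs_le.1 (hl (σ z) (by simpa using hz))
      rw [σ.norm_map] at h₂
      rw [lap_add (hw z hz) ((contDiffAt_const.mul (hcd z hz)).add
          (contDiffAt_const.mul (hφ z hz₀).1)),
        lap_add (contDiffAt_const.mul (hcd z hz)) (contDiffAt_const.mul (hφ z hz₀).1),
        lap_const_mul _ (hcd z hz), lap_const_mul _ (hφ z hz₀).1,
        lap_comp_linearIsometryEquiv σ (hw (σ z) (by simpa using hz))]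
      have h₃ := mul_le_mul_of_nonneg_left hlφ hA₀
      have h₄ := mul_lt_mul_of_pos_right hA₁ hP
      linarith [h₁.1, h₂.2]

/-- Comparison with `A / ‖x‖ - B * ‖x‖ ^ (-s)` outside a ball. -/
theorem exists_norm_mul_bound {q s C : ℝ} (hq : 0 < q) (hq₁ : q < 1) (hs₁ : 1 < s) (hs₂ : s < 2)
    (hC : 0 ≤ C) {w : E3 → ℝ} (hw : ∀ x, 2 ≤ ‖x‖ → ContDiffAt ℝ 2 w x)
    (hb : ∀ x, 2 ≤ ‖x‖ → |w x| ≤ C * ‖x‖ ^ (-q))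
    (hl : ∀ x, 2 ≤ ‖x‖ → |lap w x| ≤ C * ‖x‖ ^ (-(2 + s))) :
    ∃ K ≥ 0, ∀ x y : E3, 2 ≤ ‖x‖ → ‖x‖ ≤ ‖y‖ →
      ‖y‖ * w y ≤ ‖x‖ * w x + K * ‖x‖ ^ (1 - s) := by
  obtain ⟨K, hK₀, hK⟩ := exists_oscillation_bound hq hs₁ hs₂ hC hw hb hl
  set B : ℝ := (C + 1) / (s * (s - 1))
  have hss : 0 < s * (s - 1) := mul_pos (by linarith) (by linarith)
  have hB : B * (s * (s - 1)) = C + 1 := div_mul_cancel₀ _ hss.ne'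
  have hB₀ : 0 ≤ B := by positivity
  refine ⟨K + B, by positivity, fun x y hx hxy => ?_⟩
  have hr : 0 < ‖x‖ := by linarith
  set A : ℝ := ‖x‖ * w x + (K + B) * ‖x‖ ^ (1 - s)
  have hpow (r : ℝ) (hr : 0 < r) : r ^ (1 - s) = r * r ^ (-s) := by
    rw [← Real.rpow_one_add' hr.le (by linarith)]
    rfl
  set v : E3 → ℝ := fun z => w z + ((-A) * ‖z‖ ^ (-1 : ℝ) + B * ‖z‖ ^ (-s))
  have hv (z : E3) (hz : ‖x‖ ≤ ‖z‖) : ContDiffAt ℝ 2 v z := by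
    have hz₀ := ne_zero_of_two_le_norm (hx.trans hz)
    exact (hw z (hx.trans hz)).add ((contDiffAt_const.mul (contDiffAt_norm_rpow hz₀ _)).add
      (contDiffAt_const.mul (contDiffAt_norm_rpow hz₀ _)))
  have hnonpos := nonpos_of_lap_pos (D := {z : E3 | ‖x‖ ≤ ‖z‖}) (v := v) (q := q)
    (K := C + |A| + B) (isClosed_le continuous_const continuous_norm)
    (fun z hz => (hv z hz).continuousAt.continuousWithinAt) hq ?_ ?_ y hxy
  · have hy : 0 < ‖y‖ := hr.trans_le hxy
    have hBy : 0 ≤ B * ‖y‖ ^ (-s) := by positivity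
    simp only [v, Real.rpow_neg_one] at hnonpos
    have h : w y ≤ A * ‖y‖⁻¹ := by linarith
    calc ‖y‖ * w y ≤ ‖y‖ * (A * ‖y‖⁻¹) := mul_le_mul_of_nonneg_left h hy.le
      _ = A := by field_simp
  · intro z hz
    have hz₂ : 2 ≤ ‖z‖ := hx.trans hz
    have h₁ := (abs_le.1 (hb z hz₂)).2
    have h₂ : (-A) * ‖z‖ ^ (-1 : ℝ) ≤ |A| * ‖z‖ ^ (-q) :=
      mul_le_mul (neg_le_abs A) (rpow_le_rpow_of_two_le hz₂ (by linarith)) (by positivity)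
        (abs_nonneg A)
    have h₃ : B * ‖z‖ ^ (-s) ≤ B * ‖z‖ ^ (-q) :=
      mul_le_mul_of_nonneg_left (rpow_le_rpow_of_two_le hz₂ (by linarith)) hB₀
    simp only [v]
    linarith
  · intro z hz hvz
    have hz₂ : 2 ≤ ‖z‖ := hx.trans hz
    have hz₀ := ne_zero_of_two_le_norm hz₂
    refine ⟨?_, hv z hz, ?_⟩
    · have hlt : ‖x‖ < ‖z‖ := by
        refine lt_of_le_of_ne hz fun heq => ?_
        have h₁ := hK z x hz₂ heq.symm
        have h₂ : A * ‖x‖⁻¹ = w x + (K + B) * ‖x‖ ^ (-s) := by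
          simp only [A, hpow _ hr]
          field_simp
        simp only [v, Real.rpow_neg_one, ← heq] at hvz h₁
        linarith
      filter_upwards [continuous_norm.continuousAt.eventually (lt_mem_nhds hlt)] with p hp
        using hp.le
    · have hP : 0 < ‖z‖ ^ (-(2 + s)) := by positivity
      have h₁ := contDiffAt_norm_rpow hz₀ (-1)
      have h₂ := contDiffAt_norm_rpow hz₀ (-s)
      have h₃ := (abs_le.1 (hl z hz₂)).1
      rw [lap_add (hw z hz₂) ((contDiffAt_const.mul h₁).add (contDiffAt_const.mul h₂)),
        lap_add (contDiffAt_const.mul h₁) (contDiffAt_const.mul h₂),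
        lap_const_mul _ h₁, lap_const_mul _ h₂, lap_norm_rpow hz₀, lap_norm_rpow hz₀,
        show -s - 2 = -(2 + s) by ring]
      have h₄ : B * (-s * (-s + 1) * ‖z‖ ^ (-(2 + s))) = (C + 1) * ‖z‖ ^ (-(2 + s)) := by
        rw [← hB]
        ring
      rw [h₄]
      linarith

/-- if `w` is C² on `{|x| ≥ 1}` with `|w| ≤ C r^{−q}` and `|Δw| ≤ C r^{−2−2q}`
for some `q ∈ (1/2, 1)`, then `w` is harmonic up to lower order terms:
`w = a/r + O(r^{−2q})` on `{|x| ≥ 2}`. -/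
theorem harmonic_expansion
    (q : ℝ) (hq₁ : 1 / 2 < q) (hq₂ : q < 1)
    (w : E3 → ℝ)
    (hw : ContDiffOn ℝ 2 w {x : E3 | 1 ≤ ‖x‖})
    (C : ℝ)
    (hbound : ∀ x : E3, 1 ≤ ‖x‖ → |w x| ≤ C * ‖x‖ ^ (-q))
    (hlap : ∀ x : E3, 1 ≤ ‖x‖ → |lap w x| ≤ C * ‖x‖ ^ (-(2 + 2 * q))) :
    ∃ a C' : ℝ, ∀ x : E3, 2 ≤ ‖x‖ →
      |w x - a / ‖x‖| ≤ C' * ‖x‖ ^ (-(2 * q)) := by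
  have hnhds (x : E3) (hx : 2 ≤ ‖x‖) : {x : E3 | 1 ≤ ‖x‖} ∈ 𝓝 x := by
    filter_upwards [continuous_norm.continuousAt.eventually
      (lt_mem_nhds (show (1 : ℝ) < ‖x‖ by linarith))] with y hy using hy.le
  have hw' (x : E3) (hx : 2 ≤ ‖x‖) : ContDiffAt ℝ 2 w x := hw.contDiffAt (hnhds x hx)
  have he (r : ℝ) (hr : 0 ≤ r) : ‖(EuclideanSpace.single 0 r : E3)‖ = r := by
    simp [abs_of_nonneg hr]
  have hC : 0 ≤ C := by
    have h := (abs_nonneg _).trans (hbound (EuclideanSpace.single 0 1) (he 1 zero_le_one).ge)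
    simpa [he 1 zero_le_one] using h
  obtain ⟨K₁, hK₁, h₁⟩ := exists_norm_mul_bound (q := q) (s := 2 * q) (C := C) (w := w)
    (by linarith) hq₂ (by linarith) (by linarith) hC hw'
    (fun x hx => hbound x (by linarith)) (fun x hx => hlap x (by linarith))
  obtain ⟨K₂, hK₂, h₂⟩ := exists_norm_mul_bound (q := q) (s := 2 * q) (C := C)
    (w := fun x => (-1) * w x)
    (by linarith) hq₂ (by linarith) (by linarith) hC (fun x hx => contDiffAt_const.mul (hw' x hx))
    (fun x hx => by simpa using hbound x (by linarith))
    (fun x hx => by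
      rw [lap_const_mul (-1) (hw' x hx), neg_one_mul, abs_neg]
      exact hlap x (by linarith))
  have hK (x y : E3) (hx : 2 ≤ ‖x‖) (hxy : ‖x‖ ≤ ‖y‖) :
      |‖x‖ * w x - ‖y‖ * w y| ≤ (K₁ + K₂) * ‖x‖ ^ (1 - 2 * q) := by
    have hP : 0 ≤ ‖x‖ ^ (1 - 2 * q) := by positivity
    have hP₁ := mul_nonneg hK₁ hP
    have hP₂ := mul_nonneg hK₂ hP
    have := h₁ x y hx hxy
    have := h₂ x y hx hxy
    rw [abs_le]
    constructor <;> linarith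
  set p : ℕ → E3 := fun k => EuclideanSpace.single 0 ((k : ℝ) + 2)
  have hp (k : ℕ) : ‖p k‖ = (k : ℝ) + 2 := he _ (by positivity)
  have hp_lim : Tendsto (fun k : ℕ => (k : ℝ) + 2) atTop atTop :=
    tendsto_atTop_add_const_right _ _ tendsto_natCast_atTop_atTop
  have hcauchy : CauchySeq fun k => ‖p k‖ * w (p k) := by
    refine cauchySeq_of_le_tendsto_0' (fun k : ℕ => (K₁ + K₂) * ((k : ℝ) + 2) ^ (1 - 2 * q))
      (fun k m hkm => ?_) ?_
    · rw [Real.dist_eq, ← hp k]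
      refine hK (p k) (p m) ?_ ?_
      · rw [hp]
        linarith [(Nat.cast_nonneg k : (0 : ℝ) ≤ k)]
      · rw [hp, hp]
        gcongr
    · have h := ((tendsto_rpow_neg_atTop (show 0 < 2 * q - 1 by linarith)).comp hp_lim).const_mul
        (K₁ + K₂)
      simpa [Function.comp_def] using h
  obtain ⟨a, ha⟩ := cauchySeq_tendsto_of_complete hcauchy
  refine ⟨a, K₁ + K₂, fun x hx => ?_⟩
  have hr : 0 < ‖x‖ := by linarith
  have hlim : |‖x‖ * w x - a| ≤ (K₁ + K₂) * ‖x‖ ^ (1 - 2 * q) := by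
    refine le_of_tendsto (tendsto_const_nhds.sub ha).abs ?_
    filter_upwards [hp_lim.eventually_ge_atTop ‖x‖] with k hk
    exact hK x (p k) hx (by rwa [hp])
  have hsplit : w x - a / ‖x‖ = (‖x‖ * w x - a) / ‖x‖ := by field_simp
  rw [hsplit, abs_div, abs_norm, div_le_iff₀ hr, mul_assoc, ← Real.rpow_add_one hr.ne',
    neg_add_eq_sub]
  exact hlim
end
end
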